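/- arXiv:1108.1283 — 6 statements merged into one kernel-verified Lean document; each statement's English description precedes it below -/
import Mathlib

section
/- There exists a universal constant C > 0 such that for every ε ∈ (0, 1/2) and every large enough integer N (depending on ε) there exist an integer m and an N-point subset S of ℝ^m (equipped with the ℓ1 norm) with the following property: for every integer d ≥ 1 and every map F : S → ℝ^d satisfying (1/(1+ε))·‖x − y‖₁ ≤ ‖F(x) − F(y)‖₁ ≤ ‖x − y‖₁ for all x, y ∈ S (i.e., F is an embedding into ℓ1^d with distortion at most 1+ε), one has d ≥ N^{1 − C/log₂(1/ε)}. -/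
/-- The ℓ1 norm of a vector in ℝ^d: the sum of the absolute values of its coordinates. -/
def l1norm {d : ℕ} (v : Fin d → ℝ) : ℝ := ∑ j, |v j|

theorem mul_log_add_le {a T p : ℝ} (ha : 0 ≤ a) (hT : 0 < T) (hp : 0 < p) :
    a * Real.log T ≤ a * Real.log a + a * Real.log (1 / p) + (T * p - a) := by
  rcases ha.eq_or_lt with rfl | ha
  · simp only [zero_mul]; nlinarith [mul_pos hT hp]
  · have h := Real.log_le_sub_one_of_pos (show 0 < T * p / a by positivity)
    rw [Real.log_div (by positivity) ha.ne', Real.log_mul hT.ne' hp.ne'] at h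
    have h2 := mul_le_mul_of_nonneg_left h ha.le
    have h3 : a * (T * p / a - 1) = T * p - a := by field_simp
    rw [one_div, Real.log_inv]
    nlinarith

/-- The log-sum inequality with a reference distribution `p`. -/
theorem sum_mul_log_sum_le {α : Type*} (s : Finset α) (S p : α → ℝ) (hS : ∀ c ∈ s, 0 ≤ S c)
    (hp : ∀ c ∈ s, 0 < p c) (hp1 : ∑ c ∈ s, p c ≤ 1) :
    (∑ c ∈ s, S c) * Real.log (∑ c ∈ s, S c) ≤
      ∑ c ∈ s, S c * Real.log (S c) + ∑ c ∈ s, S c * Real.log (1 / p c) := by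
  set T := ∑ c ∈ s, S c with hT
  rcases (Finset.sum_nonneg hS).eq_or_lt with h0 | h0
  · have hz := (Finset.sum_eq_zero_iff_of_nonneg hS).1 h0.symm
    rw [hT, ← h0, Finset.sum_eq_zero (fun c hc => by rw [hz c hc, zero_mul]),
      Finset.sum_eq_zero (fun c hc => by rw [hz c hc, zero_mul])]
    simp
  · have h := Finset.sum_le_sum (fun c hc => mul_log_add_le (hS c hc) h0 (hp c hc))
    rw [← Finset.sum_mul, Finset.sum_add_distrib, Finset.sum_add_distrib,
      Finset.sum_sub_distrib, ← Finset.mul_sum] at h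
    change T * Real.log T ≤ _ at h
    have := mul_le_mul_of_nonneg_left hp1 h0.le
    change T * _ ≤ T * 1 at this
    linarith

theorem sum_abs_sub_self_le {α : Type*} (R : Finset α) (b : α → ℝ) (M k : ℝ) (hM : 0 ≤ M)
    (hk : (R.card : ℝ) ≤ k) (hk1 : 1 ≤ k) (hb : ∀ c ∈ R, |b c| ≤ M) :
    ∑ c ∈ R, (|b c| - b c) ≤ k * (M + ∑ c ∈ R, |b c| - |M + ∑ c ∈ R, b c|) := by
  have hN : ∑ c ∈ R, (|b c| - b c) ≤ R.card * (2 * M) := by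
    rw [← nsmul_eq_mul]
    refine Finset.sum_le_card_nsmul _ _ _ fun c hc => ?_
    have := hb c hc
    have := neg_abs_le (b c)
    linarith
  have hN0 : 0 ≤ ∑ c ∈ R, (|b c| - b c) :=
    Finset.sum_nonneg fun c _ => sub_nonneg.2 (le_abs_self _)
  have hP0 : 0 ≤ ∑ c ∈ R, (|b c| + b c) :=
    Finset.sum_nonneg fun c _ => by linarith [neg_abs_le (b c)]
  rw [Finset.sum_sub_distrib] at *
  rw [Finset.sum_add_distrib] at hP0
  rcases le_total 0 (M + ∑ c ∈ R, b c) with h | h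
  · rw [abs_of_nonneg h]; nlinarith
  · rw [abs_of_nonpos h]
    have : (R.card : ℝ) * (2 * M) ≤ k * (2 * M) := by gcongr
    nlinarith

theorem cycle_error_le_of_max_zero (k : ℕ) (hk : 1 ≤ k) (b : ℕ → ℝ) (hper : b (2 * k) = b 0)
    (hmax : ∀ c, |b c| ≤ |b 0|) (hsum : ∑ c ∈ Finset.range (2 * k), b c = 0) :
    ∑ c ∈ Finset.Ico 1 k, |b c| + ∑ c ∈ Finset.Ico (k + 1) (2 * k), |b c| ≤
      k * ((∑ c ∈ Finset.Ico 0 k, |b c| - |∑ c ∈ Finset.Ico 0 k, b c|) +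
        (∑ c ∈ Finset.Ico (k + 1) (2 * k + 1), |b c| -
          |∑ c ∈ Finset.Ico (k + 1) (2 * k + 1), b c|)) := by
  wlog h0 : 0 ≤ b 0 generalizing b
  · have := this (fun c => - b c) (by simp [hper]) (by simpa using hmax) (by simp [hsum])
      (by simp; linarith)
    simpa only [abs_neg, Finset.sum_neg_distrib] using this
  have e1 : ∀ g : ℕ → ℝ, ∑ c ∈ Finset.Ico 0 k, g c = g 0 + ∑ c ∈ Finset.Ico 1 k, g c :=
    fun g => Finset.sum_eq_sum_Ico_succ_bot hk g
  have e2 : ∀ g : ℕ → ℝ, ∑ c ∈ Finset.Ico (k + 1) (2 * k + 1), g c =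
      g (2 * k) + ∑ c ∈ Finset.Ico (k + 1) (2 * k), g c :=
    fun g => by rw [Finset.sum_Ico_succ_top (by omega), add_comm]
  have e3 : b 0 + ∑ c ∈ Finset.Ico 1 k, b c + b k + ∑ c ∈ Finset.Ico (k + 1) (2 * k), b c = 0 := by
    rw [← hsum, Finset.range_eq_Ico, ← Finset.sum_Ico_consecutive b (Nat.zero_le k) (by omega),
      e1 b, Finset.sum_eq_sum_Ico_succ_bot (show k < 2 * k by omega) b]
    ring
  have hk' : (1 : ℝ) ≤ k := by exact_mod_cast hk
  have habs : ∀ c, |b c| ≤ b 0 := fun c => (hmax c).trans_eq (abs_of_nonneg h0)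
  have l1 := sum_abs_sub_self_le (Finset.Ico 1 k) b (b 0) k h0 (by simp) hk' fun c _ => habs c
  have l2 := sum_abs_sub_self_le (Finset.Ico (k + 1) (2 * k)) b (b 0) k h0
    (by rw [Nat.card_Ico]; exact_mod_cast (by omega)) hk' fun c _ => habs c
  rw [e1, e1, e2, e2, hper, abs_of_nonneg h0, mul_add]
  rw [Finset.sum_sub_distrib] at l1 l2
  have := neg_abs_le (b k)
  have := habs k
  linarith

theorem sum_range_shift_of_periodic (g : ℕ → ℝ) (L : ℕ) (hg : ∀ c, g (c + L) = g c) (m : ℕ) :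
    ∑ c ∈ Finset.range L, g (m + c) = ∑ c ∈ Finset.range L, g c := by
  induction m with
  | zero => simp
  | succ m ih =>
    rw [← ih]
    have h1 := Finset.sum_range_succ (fun c => g (m + c)) L
    have h2 := Finset.sum_range_succ' (fun c => g (m + c)) L
    rw [h1] at h2
    rw [hg m, add_zero, add_right_cancel_iff] at h2
    rw [h2]
    exact Finset.sum_congr rfl fun c _ => congrArg g (by omega)

/-- The failure of the `k`-step walk of `y` from `s` to be monotone. -/
def windowDefect (y : ℕ → ℝ) (k s : ℕ) : ℝ :=
  ∑ c ∈ Finset.range k, |y (s + c + 1) - y (s + c)| - |y (s + k) - y s|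

theorem sum_range_add_sub (y : ℕ → ℝ) (s k : ℕ) :
    ∑ c ∈ Finset.range k, (y (s + c + 1) - y (s + c)) = y (s + k) - y s :=
  Finset.sum_range_sub (fun c => y (s + c)) k

theorem windowDefect_nonneg (y : ℕ → ℝ) (k s : ℕ) : 0 ≤ windowDefect y k s := by
  rw [windowDefect, ← sum_range_add_sub, sub_nonneg]
  exact Finset.abs_sum_le_sum_abs _ _

theorem exists_cycle_error_le (k : ℕ) (hk : 1 ≤ k) (y : ℕ → ℝ)
    (hper : ∀ s, y (s + 2 * k) = y s) :
    ∃ r < k, ∑ c ∈ Finset.range (2 * k), (if c % k = r then 0 else |y (c + 1) - y c|) ≤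
      2 * k * ∑ s ∈ Finset.range (4 * k), windowDefect y k s := by
  obtain ⟨i, hi, hmax⟩ := Finset.exists_max_image (Finset.range (2 * k))
    (fun c => |y (c + 1) - y c|) ⟨0, by simp; omega⟩
  rw [Finset.mem_range] at hi
  have hmod : ∀ c, y (c % (2 * k)) = y c := by
    intro c
    conv_rhs => rw [← Nat.mod_add_div c (2 * k)]
    generalize c / (2 * k) = q
    induction q with
    | zero => simp
    | succ q ih => rw [Nat.mul_succ, ← add_assoc, hper, ih]
  have hper1 : ∀ s, y (s + 2 * k + 1) = y (s + 1) := fun s => by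
    rw [show s + 2 * k + 1 = s + 1 + 2 * k by omega, hper]
  have hmax' : ∀ c, |y (c + 1) - y c| ≤ |y (i + 1) - y i| := by
    intro c
    have h := hmax (c % (2 * k)) (by rw [Finset.mem_range]; exact Nat.mod_lt _ (by omega))
    have h1 : y (c % (2 * k) + 1) = y (c + 1) := by
      rw [← hmod, ← hmod (c + 1), Nat.mod_add_mod]
    rwa [h1, hmod] at h
  refine ⟨i % k, Nat.mod_lt _ hk, ?_⟩
  rw [← sum_range_shift_of_periodic _ _ (fun c => ?_) i]
  swap
  · rw [show (c + 2 * k) % k = c % k by simp, hper, hper1]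
  have key := cycle_error_le_of_max_zero k hk (fun c => y (i + c + 1) - y (i + c))
    (by rw [hper1, hper, add_zero]) (fun c => by simpa using hmax' (i + c))
    (by rw [sum_range_add_sub, hper, sub_self])
  have hsplit : ∑ c ∈ Finset.range (2 * k),
      (if (i + c) % k = i % k then 0 else |y (i + c + 1) - y (i + c)|) ≤
      ∑ c ∈ Finset.Ico 1 k, |y (i + c + 1) - y (i + c)| +
        ∑ c ∈ Finset.Ico (k + 1) (2 * k), |y (i + c + 1) - y (i + c)| := by
    have hle : ∀ c, (if (i + c) % k = i % k then 0 else |y (i + c + 1) - y (i + c)|) ≤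
        |y (i + c + 1) - y (i + c)| := fun c => by split_ifs <;> simp
    rw [Finset.range_eq_Ico, ← Finset.sum_Ico_consecutive _ (Nat.zero_le k) (by omega),
      Finset.sum_eq_sum_Ico_succ_bot hk, Finset.sum_eq_sum_Ico_succ_bot (show k < 2 * k by omega)]
    simp only [add_zero, if_true, Nat.add_mod_right, zero_add]
    exact add_le_add (Finset.sum_le_sum fun c _ => hle c) (Finset.sum_le_sum fun c _ => hle c)
  have hw1 : ∑ c ∈ Finset.Ico 0 k, |y (i + c + 1) - y (i + c)| -
      |∑ c ∈ Finset.Ico 0 k, (y (i + c + 1) - y (i + c))| = windowDefect y k i := by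
    rw [← Finset.range_eq_Ico, sum_range_add_sub, windowDefect]
  have hw2 : ∑ c ∈ Finset.Ico (k + 1) (2 * k + 1), |y (i + c + 1) - y (i + c)| -
      |∑ c ∈ Finset.Ico (k + 1) (2 * k + 1), (y (i + c + 1) - y (i + c))| =
      windowDefect y k (i + (k + 1)) := by
    rw [Finset.sum_Ico_eq_sum_range, Finset.sum_Ico_eq_sum_range,
      show 2 * k + 1 - (k + 1) = k by omega, windowDefect, ← sum_range_add_sub]
    simp only [add_assoc]
  rw [hw1, hw2] at key
  have hmem : ∀ s < 4 * k, windowDefect y k s ≤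
      ∑ s ∈ Finset.range (4 * k), windowDefect y k s := fun s hs =>
    Finset.single_le_sum (f := windowDefect y k) (fun s _ => windowDefect_nonneg y k s)
      (Finset.mem_range.2 hs)
  have hk0 : (0 : ℝ) ≤ k := Nat.cast_nonneg k
  have m1 := mul_le_mul_of_nonneg_left (hmem i (by omega)) hk0
  have m2 := mul_le_mul_of_nonneg_left (hmem (i + (k + 1)) (by omega)) hk0
  linarith

theorem sum_guess_weights (k r : ℕ) (hr : r < k) :
    ∑ c ∈ Finset.range (2 * k), (1 / (4 * k) + if c % k = r then 1 / 4 else 0 : ℝ) = 1 := by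
  have hk : (k : ℝ) ≠ 0 := by exact_mod_cast (by omega : k ≠ 0)
  have h : ∑ c ∈ Finset.range k, (if c % k = r then (1 / 4 : ℝ) else 0) = 1 / 4 := by
    rw [Finset.sum_congr rfl (g := fun c => if c = r then (1 / 4 : ℝ) else 0)
      fun c hc => by rw [Nat.mod_eq_of_lt (Finset.mem_range.1 hc)]]
    simp [hr]
  have h2 : ∑ c ∈ Finset.range (2 * k), (if c % k = r then (1 / 4 : ℝ) else 0) = 1 / 2 := by
    rw [two_mul, Finset.sum_range_add]
    simp only [Nat.add_mod_left, h]
    norm_num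
  rw [Finset.sum_add_distrib, h2, Finset.sum_const, Finset.card_range, nsmul_eq_mul]
  push_cast
  field_simp
  norm_num

theorem entropy_le_of_guess (k r : ℕ) (hr : r < k) (S : ℕ → ℝ)
    (hS : ∀ c ∈ Finset.range (2 * k), 0 ≤ S c) :
    (∑ c ∈ Finset.range (2 * k), S c) * Real.log (∑ c ∈ Finset.range (2 * k), S c) ≤
      ∑ c ∈ Finset.range (2 * k), S c * Real.log (S c) +
      (Real.log 4 * ∑ c ∈ Finset.range (2 * k), S c +
        Real.log (4 * k) * ∑ c ∈ Finset.range (2 * k), if c % k = r then 0 else S c) := by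
  have hk : (0 : ℝ) < k := by exact_mod_cast (by omega : 0 < k)
  have hp : ∀ c ∈ Finset.range (2 * k),
      (0 : ℝ) < 1 / (4 * k) + if c % k = r then 1 / 4 else 0 := fun c _ => by
    split_ifs <;> positivity
  refine (sum_mul_log_sum_le _ S _ hS hp (sum_guess_weights k r hr).le).trans ?_
  refine add_le_add le_rfl ?_
  rw [Finset.mul_sum, Finset.mul_sum, ← Finset.sum_add_distrib]
  refine Finset.sum_le_sum fun c hc => ?_
  have hc0 := hS c hc
  have h4 : 0 ≤ Real.log 4 := Real.log_nonneg (by norm_num)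
  split_ifs with h
  · rw [mul_zero, add_zero, mul_comm]
    refine mul_le_mul_of_nonneg_right (Real.log_le_log (by positivity) ?_) hc0
    rw [div_le_iff₀ (by positivity)]
    have : (0 : ℝ) < 1 / (4 * k) := by positivity
    linarith
  · rw [add_zero, one_div_one_div]
    nlinarith

theorem entropy_step {d k : ℕ} (hk : 1 ≤ k) {ε A M : ℝ} (hA : 0 ≤ A)
    (y : Fin d → ℕ → ℝ) (hper : ∀ j s, y j (s + 2 * k) = y j s) (S : ℕ → Fin d → ℝ)
    (hSy : ∀ c < 2 * k, ∀ j, A * |y j (c + 1) - y j c| ≤ S c j)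
    (hST : ∀ c < 2 * k, ∑ j, S c j ≤ A * M)
    (hup : ∀ c, ∑ j, |y j (c + 1) - y j c| ≤ M)
    (hlow1 : ∀ c, M * (1 - ε) ≤ ∑ j, |y j (c + 1) - y j c|)
    (hlow : ∀ s, k * M * (1 - ε) ≤ ∑ j, |y j (s + k) - y j s|) :
    ∑ j, (∑ c ∈ Finset.range (2 * k), S c j) *
        Real.log (∑ c ∈ Finset.range (2 * k), S c j) ≤
      ∑ c ∈ Finset.range (2 * k), ∑ j, S c j * Real.log (S c j) +
        2 * k * (A * M) * (Real.log 4 + Real.log (4 * k) * ((1 + 4 * k ^ 2) * ε)) := by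
  have hk1 : (1 : ℝ) ≤ k := by exact_mod_cast hk
  have hS0 : ∀ c < 2 * k, ∀ j, 0 ≤ S c j := fun c hc j =>
    (mul_nonneg hA (abs_nonneg _)).trans (hSy c hc j)
  choose r hr herr using fun j => exists_cycle_error_le k hk (y j) (hper j)
  have hdef : ∀ s, ∑ j, windowDefect (y j) k s ≤ k * M * ε := by
    intro s
    simp only [windowDefect, Finset.sum_sub_distrib]
    rw [Finset.sum_comm]
    have h1 := Finset.sum_le_card_nsmul (Finset.range k)
      (fun c => ∑ j, |y j (s + c + 1) - y j (s + c)|) M fun c _ => hup (s + c)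
    rw [Finset.card_range, nsmul_eq_mul] at h1
    linarith [hlow s]
  have herrT : ∑ j, ∑ c ∈ Finset.range (2 * k),
      (if c % k = r j then 0 else |y j (c + 1) - y j c|) ≤ 8 * k ^ 3 * M * ε := by
    refine (Finset.sum_le_sum fun j _ => herr j).trans ?_
    rw [← Finset.mul_sum, Finset.sum_comm]
    have h1 := Finset.sum_le_card_nsmul (Finset.range (4 * k))
      (fun s => ∑ j, windowDefect (y j) k s) _ fun s _ => hdef s
    rw [Finset.card_range, nsmul_eq_mul] at h1
    push_cast at h1
    have := mul_le_mul_of_nonneg_left h1 (by positivity : (0 : ℝ) ≤ 2 * k)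
    linarith
  have hexc : ∑ c ∈ Finset.range (2 * k), ∑ j, (S c j - A * |y j (c + 1) - y j c|) ≤
      2 * k * (A * M * ε) := by
    refine (Finset.sum_le_card_nsmul _ _ (A * M * ε) fun c hc => ?_).trans_eq
      (by rw [Finset.card_range, nsmul_eq_mul]; push_cast; ring)
    rw [Finset.sum_sub_distrib, ← Finset.mul_sum]
    have := mul_le_mul_of_nonneg_left (hlow1 c) hA
    have := hST c (Finset.mem_range.1 hc)
    linarith
  have hmiss : ∑ j, ∑ c ∈ Finset.range (2 * k), (if c % k = r j then 0 else S c j) ≤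
      2 * k * (A * M) * ((1 + 4 * k ^ 2) * ε) := by
    have h1 : ∑ j, ∑ c ∈ Finset.range (2 * k), (if c % k = r j then 0 else S c j) ≤
        ∑ j, ∑ c ∈ Finset.range (2 * k), ((S c j - A * |y j (c + 1) - y j c|) +
          A * (if c % k = r j then 0 else |y j (c + 1) - y j c|)) := by
      refine Finset.sum_le_sum fun j _ => Finset.sum_le_sum fun c hc => ?_
      have := hSy c (Finset.mem_range.1 hc) j
      split_ifs <;> linarith
    simp only [Finset.sum_add_distrib, ← Finset.mul_sum] at h1
    rw [Finset.sum_comm (f := fun j c => S c j - A * |y j (c + 1) - y j c|)] at h1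
    have := mul_le_mul_of_nonneg_left herrT hA
    linarith
  have hlog4 : 0 ≤ Real.log 4 := Real.log_nonneg (by norm_num)
  have hlogk : 0 ≤ Real.log (4 * k) := Real.log_nonneg (by linarith)
  have htot : ∑ j, ∑ c ∈ Finset.range (2 * k), S c j ≤ 2 * k * (A * M) := by
    rw [Finset.sum_comm]
    refine (Finset.sum_le_card_nsmul _ _ (A * M) fun c hc =>
      hST c (Finset.mem_range.1 hc)).trans_eq ?_
    rw [Finset.card_range, nsmul_eq_mul]; push_cast; ring
  refine (Finset.sum_le_sum fun j _ => entropy_le_of_guess k (r j) (hr j) (fun c => S c j)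
    fun c hc => hS0 c (Finset.mem_range.1 hc) j).trans ?_
  rw [Finset.sum_add_distrib, Finset.sum_add_distrib, ← Finset.mul_sum, ← Finset.mul_sum,
    Finset.sum_comm (f := fun j c => S c j * Real.log (S c j))]
  have := mul_le_mul_of_nonneg_left hmiss hlogk
  have := mul_le_mul_of_nonneg_left htot hlog4
  linarith

/-- `F` restricted to `V` is an `ℓ1` embedding with distortion at most `1 + ε`. -/
def LowDistortionOn {ι : Type} [Fintype ι] {d : ℕ} (ε : ℝ) (V : Finset (ι → ℝ))
    (F : (ι → ℝ) → Fin d → ℝ) : Prop :=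
  ∀ x ∈ V, ∀ y ∈ V, (1 / (1 + ε)) * ∑ i, |x i - y i| ≤ ∑ j, |F x j - F y j| ∧
    ∑ j, |F x j - F y j| ≤ ∑ i, |x i - y i|

/-- The vertices, indexed modulo `2 * k`, of a cycle in the cube in which first all blocks are
switched on one after the other, and then switched off in the same order. -/
def cycleVertex (ι : Type) (k s : ℕ) : Fin k × ι → ℝ := fun q =>
  if (q.1 : ℕ) < s % (2 * k) ∧ s % (2 * k) ≤ q.1 + k then 1 else 0

/-- The isometry placing a cube on the `c`-th edge of the cycle `cycleVertex`. -/
def cycleEdgeMap {ι : Type} (k c : ℕ) (p : ι → ℝ) : Fin k × ι → ℝ := fun q =>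
  if (q.1 : ℕ) = c % k then p q.2 else cycleVertex ι k c q

theorem mod_cases_of_lt {k c : ℕ} (hc : c < 2 * k) :
    c < k ∧ c % k = c ∨ k ≤ c ∧ c % k = c - k := by
  rcases lt_or_ge c k with h | h
  · exact Or.inl ⟨h, Nat.mod_eq_of_lt h⟩
  · exact Or.inr ⟨h, by rw [Nat.mod_eq_sub_mod h, Nat.mod_eq_of_lt (by omega)]⟩

theorem succ_mod_cases {L c : ℕ} (hc : c < L) :
    (c + 1) % L = c + 1 ∧ c + 1 < L ∨ (c + 1) % L = 0 ∧ c + 1 = L := by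
  rcases lt_or_eq_of_le (Nat.succ_le_of_lt hc) with h | h
  · exact Or.inl ⟨Nat.mod_eq_of_lt h, h⟩
  · exact Or.inr ⟨by rw [← h]; exact Nat.mod_self _, h⟩

theorem cycleEdgeMap_endpoints {ι : Type} {k c : ℕ} (hc : c < 2 * k) :
    (cycleEdgeMap k c 0 = cycleVertex ι k c ∧ cycleEdgeMap k c 1 = cycleVertex ι k (c + 1)) ∨
    (cycleEdgeMap k c 1 = cycleVertex ι k c ∧ cycleEdgeMap k c 0 = cycleVertex ι k (c + 1)) := by
  have h2 := succ_mod_cases hc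
  have h3 := Nat.mod_eq_of_lt hc
  rcases mod_cases_of_lt hc with ⟨h, h'⟩ | ⟨h, h'⟩
  · left
    constructor <;> funext ⟨⟨q, hq⟩, l⟩ <;>
      simp only [cycleEdgeMap, cycleVertex, h', h3, Pi.zero_apply, Pi.one_apply] <;>
      split_ifs <;> first | rfl | (exfalso; omega)
  · right
    constructor <;> funext ⟨⟨q, hq⟩, l⟩ <;>
      simp only [cycleEdgeMap, cycleVertex, h', h3, Pi.zero_apply, Pi.one_apply] <;>
      split_ifs <;> first | rfl | (exfalso; omega)

theorem cycleVertex_mod (ι : Type) (k s : ℕ) :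
    cycleVertex ι k (s % (2 * k)) = cycleVertex ι k s := by
  unfold cycleVertex; simp only [Nat.mod_mod]

theorem cycleVertex_zero (ι : Type) (k : ℕ) : cycleVertex ι k 0 = 0 := by
  funext q; simp [cycleVertex]

theorem cycleVertex_self (ι : Type) (k : ℕ) : cycleVertex ι k k = 1 := by
  funext ⟨⟨q, hq⟩, l⟩
  have : k % (2 * k) = k := Nat.mod_eq_of_lt (by omega)
  simp only [cycleVertex, this, Pi.one_apply]
  rw [if_pos (by omega)]

theorem sum_abs_cycleEdgeMap_sub {ι : Type} [Fintype ι] {k : ℕ} (hk : 1 ≤ k) (c : ℕ)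
    (p p' : ι → ℝ) :
    ∑ q, |cycleEdgeMap k c p q - cycleEdgeMap k c p' q| = ∑ l, |p l - p' l| := by
  rw [Fintype.sum_prod_type, Finset.sum_eq_single (⟨c % k, Nat.mod_lt _ hk⟩ : Fin k)]
  · simp [cycleEdgeMap]
  · intro b _ hb
    have : (b : ℕ) ≠ c % k := fun h => hb (Fin.ext h)
    simp [cycleEdgeMap, this]
  · simp

theorem sum_abs_antipodal_sub {ι : Type} [Fintype ι] (k s : ℕ) :
    ∑ q, |cycleVertex ι k (s + k) q - cycleVertex ι k s q| = k * Fintype.card ι := by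
  rw [Finset.sum_congr rfl (g := fun _ => (1 : ℝ))]
  · simp
  rintro ⟨⟨q, hq⟩, l⟩ -
  have hs : s % (2 * k) < 2 * k := Nat.mod_lt _ (by omega)
  have h : (s + k) % (2 * k) = (s % (2 * k) + k) % (2 * k) := by rw [Nat.mod_add_mod]
  simp only [cycleVertex, h]
  generalize s % (2 * k) = t at hs
  rcases lt_or_ge t k with ht | ht
  · rw [Nat.mod_eq_of_lt (by omega : t + k < 2 * k)]
    split_ifs <;> first | (exfalso; omega) | norm_num
  · rw [Nat.mod_eq_sub_mod (by omega : 2 * k ≤ t + k),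
      Nat.mod_eq_of_lt (by omega : t + k - 2 * k < 2 * k)]
    split_ifs <;> first | (exfalso; omega) | norm_num

theorem exists_hard_set {k : ℕ} (hk : 1 ≤ k) (n : ℕ) :
    ∃ (ι : Type) (_ : Fintype ι) (V : Finset (ι → ℝ)), Fintype.card ι = k ^ n ∧
      V.card ≤ 2 * (2 * k) ^ n ∧ 0 ∈ V ∧ 1 ∈ V ∧
      ∀ (d : ℕ) (ε : ℝ) (F : (ι → ℝ) → Fin d → ℝ), 0 ≤ ε → LowDistortionOn ε V F →
        ∃ S : Fin d → ℝ, (∀ j, 2 ^ n * |F 1 j - F 0 j| ≤ S j) ∧ ∑ j, S j ≤ (2 * k) ^ n ∧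
          ∑ j, S j * Real.log (S j) ≤ n * (2 * k) ^ n *
            (Real.log 4 + Real.log (4 * k) * ((1 + 4 * k ^ 2) * ε)) := by
  classical
  induction n with
  | zero =>
    refine ⟨Unit, inferInstance, {0, 1}, by simp, Finset.card_le_two, by simp, by simp, ?_⟩
    intro d ε F _ hF
    have h1 : ∑ j, |F 1 j - F 0 j| ≤ 1 := by simpa using (hF 1 (by simp) 0 (by simp)).2
    refine ⟨fun j => |F 1 j - F 0 j|, by simp, by simpa using h1, ?_⟩
    simp only [Nat.cast_zero, zero_mul]
    refine Finset.sum_nonpos fun j _ => mul_nonpos_of_nonneg_of_nonpos (abs_nonneg _)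
      (Real.log_nonpos (abs_nonneg _) ?_)
    exact (Finset.single_le_sum (f := fun j => |F 1 j - F 0 j|) (fun _ _ => abs_nonneg _)
      (Finset.mem_univ j)).trans h1
  | succ n ih =>
    obtain ⟨ι, _, V, hι, hV, h0, h1, ih⟩ := ih
    set V' := (Finset.range (2 * k)).biUnion fun c => V.image (cycleEdgeMap k c) with hV'
    have hmem : ∀ c < 2 * k, ∀ p ∈ V, cycleEdgeMap k c p ∈ V' := fun c hc p hp =>
      Finset.mem_biUnion.2 ⟨c, Finset.mem_range.2 hc, Finset.mem_image_of_mem _ hp⟩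
    have hver : ∀ s, cycleVertex ι k s ∈ V' := by
      intro s
      have hs : s % (2 * k) < 2 * k := Nat.mod_lt _ (by omega)
      rw [← cycleVertex_mod]
      rcases cycleEdgeMap_endpoints (ι := ι) hs with h | h
      · rw [← h.1]; exact hmem _ hs _ h0
      · rw [← h.1]; exact hmem _ hs _ h1
    refine ⟨Fin k × ι, inferInstance, V', ?_, ?_, ?_, ?_, ?_⟩
    · rw [Fintype.card_prod, hι, Fintype.card_fin, pow_succ, mul_comm]
    · refine (Finset.card_biUnion_le_card_mul _ _ _ fun c _ =>
        Finset.card_image_le.trans hV).trans_eq ?_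
      rw [Finset.card_range]; ring
    · rw [← cycleVertex_zero ι k]; exact hver 0
    · rw [← cycleVertex_self ι k]; exact hver k
    intro d ε F hε hF
    have hFc : ∀ c < 2 * k, LowDistortionOn ε V (fun p => F (cycleEdgeMap k c p)) := by
      intro c hc p hp p' hp'
      rw [← sum_abs_cycleEdgeMap_sub hk c p p']
      exact hF _ (hmem c hc p hp) _ (hmem c hc p' hp')
    have hS : ∀ c, ∃ S : Fin d → ℝ, c < 2 * k →
        (∀ j, 2 ^ n * |F (cycleEdgeMap k c 1) j - F (cycleEdgeMap k c 0) j| ≤ S j) ∧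
        ∑ j, S j ≤ (2 * k) ^ n ∧ ∑ j, S j * Real.log (S j) ≤ n * (2 * k) ^ n *
            (Real.log 4 + Real.log (4 * k) * ((1 + 4 * k ^ 2) * ε)) := by
      intro c
      by_cases hc : c < 2 * k
      · obtain ⟨S, hS⟩ := ih d ε _ hε (hFc c hc)
        exact ⟨S, fun _ => hS⟩
      · exact ⟨0, fun h => absurd h hc⟩
    choose S hS using hS
    set y : Fin d → ℕ → ℝ := fun j s => F (cycleVertex ι k s) j with hy
    have hedge : ∀ c < 2 * k, ∀ j,
        |F (cycleEdgeMap k c 1) j - F (cycleEdgeMap k c 0) j| = |y j (c + 1) - y j c| := by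
      intro c hc j
      rcases cycleEdgeMap_endpoints (ι := ι) hc with h | h
      · rw [h.1, h.2]
      · rw [h.1, h.2, abs_sub_comm]
    have hper : ∀ j s, y j (s + 2 * k) = y j s := fun j s => by
      simp only [hy]
      rw [← cycleVertex_mod ι k (s + 2 * k), Nat.add_mod_right, cycleVertex_mod]
    have hcycmod : ∀ c j, |y j (c + 1) - y j c| =
        |y j (c % (2 * k) + 1) - y j (c % (2 * k))| := fun c j => by
      simp only [hy]
      rw [cycleVertex_mod, ← cycleVertex_mod ι k (c % (2 * k) + 1), Nat.mod_add_mod,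
        cycleVertex_mod]
    have hinv : 1 - ε ≤ 1 / (1 + ε) := by
      rw [le_div_iff₀ (by linarith)]; nlinarith
    have hkn : (0 : ℝ) ≤ (k : ℝ) ^ n := by positivity
    have hcard : (Fintype.card ι : ℝ) = (k : ℝ) ^ n := by rw [hι]; push_cast; rfl
    have hlen : ∑ l : ι, |(1 : ι → ℝ) l - (0 : ι → ℝ) l| = (k : ℝ) ^ n := by simp [hcard]
    have hone : ∀ c, (k : ℝ) ^ n * (1 - ε) ≤ ∑ j, |y j (c + 1) - y j c| ∧
        ∑ j, |y j (c + 1) - y j c| ≤ (k : ℝ) ^ n := by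
      intro c
      have hc : c % (2 * k) < 2 * k := Nat.mod_lt _ (by omega)
      have h := hFc _ hc 1 h1 0 h0
      simp only [hlen, hedge _ hc, ← hcycmod] at h
      exact ⟨le_trans (by rw [mul_comm]; gcongr) h.1, h.2⟩
    have hST : ∀ c < 2 * k, ∑ j, S c j ≤ (2 : ℝ) ^ n * (k : ℝ) ^ n := fun c hc => by
      rw [← mul_pow]; exact (hS c hc).2.1
    have hstep := entropy_step hk (A := 2 ^ n) (M := (k : ℝ) ^ n) (ε := ε) (by positivity) y hper S
      (fun c hc j => by rw [← hedge c hc]; exact (hS c hc).1 j) hST (fun c => (hone c).2)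
      (fun c => (hone c).1) (fun s => by
        have h := (hF _ (hver (s + k)) _ (hver s)).1
        rw [sum_abs_antipodal_sub, hcard] at h
        exact le_trans (by rw [mul_comm]; gcongr) h)
    refine ⟨fun j => ∑ c ∈ Finset.range (2 * k), S c j, fun j => ?_, ?_, hstep.trans ?_⟩
    · have hz : y j (2 * k) = y j 0 := by simpa using hper j 0
      have e1 := Finset.abs_sum_le_sum_abs (fun c => y j (c + 1) - y j c) (Finset.range k)
      have e2 := Finset.abs_sum_le_sum_abs (fun c => y j (k + c + 1) - y j (k + c))
        (Finset.range k)
      rw [Finset.sum_range_sub] at e1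
      rw [sum_range_add_sub, ← two_mul, hz, abs_sub_comm] at e2
      have e3 : 2 * |y j k - y j 0| ≤ ∑ c ∈ Finset.range (2 * k), |y j (c + 1) - y j c| := by
        rw [two_mul k, Finset.sum_range_add]; linarith
      have e4 : 2 ^ n * ∑ c ∈ Finset.range (2 * k), |y j (c + 1) - y j c| ≤
          ∑ c ∈ Finset.range (2 * k), S c j := by
        rw [Finset.mul_sum]
        refine Finset.sum_le_sum fun c hc => ?_
        rw [Finset.mem_range] at hc
        rw [← hedge c hc]; exact (hS c hc).1 j
      have e5 : |y j k - y j 0| = |F 1 j - F 0 j| := by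
        simp only [hy, cycleVertex_self, cycleVertex_zero]
      rw [← e5, pow_succ, mul_assoc]
      exact (mul_le_mul_of_nonneg_left e3 (by positivity)).trans e4
    · rw [Finset.sum_comm]
      refine (Finset.sum_le_card_nsmul _ _ _ fun c hc =>
        (hS c (Finset.mem_range.1 hc)).2.1).trans_eq ?_
      rw [Finset.card_range, nsmul_eq_mul]; push_cast; ring
    · refine (add_le_add_left (Finset.sum_le_card_nsmul _ _ _ fun c hc =>
        (hS c (Finset.mem_range.1 hc)).2.2) _).trans_eq ?_
      rw [Finset.card_range, nsmul_eq_mul, ← mul_pow]; push_cast; ring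

/-- The dimension bound obtained from the entropy of the images of the edges. -/
theorem log_dim_lower_bound {d k n : ℕ} (hd : 1 ≤ d) (hk : 1 ≤ k) {ε K : ℝ} (hε : 0 ≤ ε)
    (hε1 : ε ≤ 1) (hK : 0 ≤ K) (δ S : Fin d → ℝ) (hδ : ∀ j, 2 ^ n * |δ j| ≤ S j)
    (hlow : (1 / (1 + ε)) * (k : ℝ) ^ n ≤ ∑ j, |δ j|)
    (hent : ∑ j, S j * Real.log (S j) ≤ n * (2 * k) ^ n * K) :
    n * Real.log (2 * k) - Real.log 2 - 2 * n * K ≤ Real.log d := by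
  have hd' : (0 : ℝ) < d := by exact_mod_cast hd
  have hk' : (0 : ℝ) < k := by exact_mod_cast hk
  have hS0 : ∀ j, 0 ≤ S j := fun j => (by positivity : (0 : ℝ) ≤ 2 ^ n * |δ j|).trans (hδ j)
  have hT : (2 * k : ℝ) ^ n / 2 ≤ ∑ j, S j := by
    have h1 : 2 ^ n * ∑ j, |δ j| ≤ ∑ j, S j := by
      rw [Finset.mul_sum]; exact Finset.sum_le_sum fun j _ => hδ j
    have h2 : (1 : ℝ) / 2 ≤ 1 / (1 + ε) := by gcongr; linarith
    calc (2 * k : ℝ) ^ n / 2 = 2 ^ n * (1 / 2 * (k : ℝ) ^ n) := by rw [mul_pow]; ring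
      _ ≤ 2 ^ n * (1 / (1 + ε) * (k : ℝ) ^ n) := by gcongr
      _ ≤ 2 ^ n * ∑ j, |δ j| := by gcongr
      _ ≤ _ := h1
  have hpos : (0 : ℝ) < (2 * k : ℝ) ^ n / 2 := by positivity
  have hT0 := hpos.trans_le hT
  have h := sum_mul_log_sum_le Finset.univ S (fun _ => 1 / (d : ℝ)) (fun j _ => hS0 j)
    (fun _ _ => by positivity) (by simp [hd'.ne'])
  rw [← Finset.sum_mul, one_div_one_div] at h
  have hlogT : n * Real.log (2 * k) - Real.log 2 ≤ Real.log (∑ j, S j) := by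
    have := Real.log_le_log hpos hT
    rwa [Real.log_div (by positivity) (by norm_num), Real.log_pow] at this
  have hnK : n * (2 * k) ^ n * K ≤ (∑ j, S j) * (2 * n * K) := by
    have : (2 * k : ℝ) ^ n / 2 * (2 * n * K) ≤ (∑ j, S j) * (2 * n * K) := by gcongr
    linarith
  have : (∑ j, S j) * Real.log (∑ j, S j) ≤ (∑ j, S j) * (2 * n * K + Real.log d) := by
    linarith
  have := le_of_mul_le_mul_left this hT0
  linarith

theorem exists_block_count {ε : ℝ} (h0 : 0 < ε) (h1 : ε < 1 / 2) :
    ∃ k : ℕ, 1 ≤ k ∧ Real.log 4 + Real.log (4 * k) * ((1 + 4 * k ^ 2) * ε) ≤ 22 ∧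
      Real.log (1 / ε) / 3 ≤ Real.log (2 * k) := by
  set t : ℝ := (1 / ε) ^ (1 / 3 : ℝ) with ht
  have hinv : 1 < 1 / ε := by rw [lt_div_iff₀ h0]; linarith
  have ht1 : 1 ≤ t := Real.one_le_rpow hinv.le (by norm_num)
  have ht3 : t ^ 3 = 1 / ε := by
    rw [ht, ← Real.rpow_natCast, ← Real.rpow_mul (by positivity)]; norm_num
  have hk1 : 1 ≤ ⌊t⌋₊ := Nat.le_floor (by simpa using ht1)
  refine ⟨⌊t⌋₊, hk1, ?_, ?_⟩
  · have hk : (1 : ℝ) ≤ ⌊t⌋₊ := by exact_mod_cast hk1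
    have hkt : (⌊t⌋₊ : ℝ) ≤ t := Nat.floor_le (by linarith)
    generalize (⌊t⌋₊ : ℝ) = k at hk hkt
    have hk3 : k ^ 3 * ε ≤ 1 := by
      have : k ^ 3 ≤ 1 / ε := ht3 ▸ pow_le_pow_left₀ (by linarith) hkt 3
      rwa [le_div_iff₀ h0] at this
    have hl4 : Real.log 4 ≤ 2 := by
      rw [show (4 : ℝ) = 2 ^ 2 by norm_num, Real.log_pow]
      have := Real.log_two_lt_d9
      push_cast
      linarith
    have hlk : Real.log (4 * k) ≤ 4 * k := (Real.log_le_self (by linarith))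
    have h5 : (1 + 4 * k ^ 2) * ε ≤ 5 * k ^ 2 * ε := by gcongr; nlinarith
    have := mul_le_mul hlk h5 (by positivity) (by linarith)
    nlinarith
  · have hlt : t ≤ 2 * ⌊t⌋₊ := by
      have := Nat.lt_floor_add_one t
      have hk : (1 : ℝ) ≤ ⌊t⌋₊ := by exact_mod_cast hk1
      linarith
    have := Real.log_le_log (by linarith) hlt
    rw [ht, Real.log_rpow (by positivity)] at this
    linarith

theorem exists_depth {k N : ℕ} (hk : 1 ≤ k) (hN : 2 ≤ N) :
    ∃ n : ℕ, 2 * (2 * k) ^ n ≤ N ∧ N < 2 * (2 * k) ^ (n + 1) := by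
  refine ⟨Nat.log (2 * k) (N / 2), ?_, ?_⟩
  · have := Nat.pow_log_le_self (2 * k) (show N / 2 ≠ 0 by omega)
    omega
  · have := Nat.lt_pow_succ_log_self (show 1 < 2 * k by omega) (N / 2)
    rw [Nat.succ_eq_add_one] at this
    omega

/-- There exists a universal constant `C > 0` such that for every `ε ∈ (0, 1/2)` and every
large enough integer `N` (depending on `ε`) there exist an integer `m` and an `N`-point
subset `S` of `ℝ^m` (with the ℓ1 norm) such that for every `d ≥ 1` and every map
`F : S → ℝ^d` that is an embedding of `S` into `ℓ1^d` with distortion at most `1+ε`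
(i.e., `(1/(1+ε))·‖x−y‖₁ ≤ ‖F x − F y‖₁ ≤ ‖x−y‖₁` for all `x, y ∈ S`), one has
`d ≥ N^(1 − C/log₂(1/ε))`. -/
theorem l1_dimension_reduction_lower_bound_low_distortion :
    ∃ C : ℝ, 0 < C ∧ ∀ ε : ℝ, 0 < ε → ε < 1 / 2 →
      ∃ N₀ : ℕ, ∀ N : ℕ, N₀ ≤ N →
        ∃ m : ℕ, ∃ S : Finset (Fin m → ℝ), S.card = N ∧
          ∀ d : ℕ, 1 ≤ d →
            ∀ F : {x // x ∈ S} → (Fin d → ℝ),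
              (∀ x y : {x // x ∈ S},
                (1 / (1 + ε)) * l1norm ((x : Fin m → ℝ) - (y : Fin m → ℝ)) ≤
                    l1norm (F x - F y) ∧
                l1norm (F x - F y) ≤ l1norm ((x : Fin m → ℝ) - (y : Fin m → ℝ))) →
              (N : ℝ) ^ (1 - C / Real.logb 2 (1 / ε)) ≤ (d : ℝ) := by
  refine ⟨300, by norm_num, fun ε h0 h1 => ?_⟩
  obtain ⟨k, hk, hK, hlogk⟩ := exists_block_count h0 h1
  set L := Real.logb 2 (1 / ε) with hL
  have hl2 := Real.log_two_gt_d9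
  have hl2' := Real.log_two_lt_d9
  have hLlog : L * Real.log 2 = Real.log (1 / ε) := by
    rw [hL, Real.logb, div_mul_cancel₀ _ (by linarith)]
  have hLpos : 0 < L := Real.logb_pos (by norm_num) (by rw [lt_div_iff₀ h0]; linarith)
  obtain ⟨N₀, hN₀⟩ := Filter.eventually_atTop.1
    ((Real.tendsto_log_atTop.comp tendsto_natCast_atTop_atTop).eventually_ge_atTop
      (L * (Real.log (2 * k) + 2 * Real.log 2)))
  refine ⟨max N₀ 2, fun N hN => ?_⟩
  have hlogN : L * (Real.log (2 * k) + 2 * Real.log 2) ≤ Real.log N :=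
    hN₀ N ((le_max_left _ _).trans hN)
  have hN2 : 2 ≤ N := (le_max_right _ _).trans hN
  obtain ⟨n, hn1, hn2⟩ := exists_depth hk hN2
  obtain ⟨ι, _, V, hι, hV, hV0, hV1, hard⟩ := exists_hard_set hk n
  have : Nonempty ι := Fintype.card_pos_iff.1 (hι ▸ pow_pos hk n)
  obtain ⟨S, hVS, hS⟩ := Infinite.exists_superset_card_eq
    (V.map ((Fintype.equivFin ι).arrowCongr (Equiv.refl ℝ)).toEmbedding) N
    (by rw [Finset.card_map]; exact hV.trans hn1)
  refine ⟨Fintype.card ι, S, hS, fun d hd F hF => ?_⟩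
  set T := (Fintype.equivFin ι).arrowCongr (Equiv.refl ℝ) with hTdef
  have hmem : ∀ p ∈ V, T p ∈ S := fun p hp => hVS (Finset.mem_map_of_mem _ hp)
  have hiso : ∀ p q : ι → ℝ, l1norm (T p - T q) = ∑ i, |p i - q i| := fun p q =>
    Equiv.sum_comp (Fintype.equivFin ι).symm fun i => |p i - q i|
  set G : (ι → ℝ) → Fin d → ℝ := fun p => if h : T p ∈ S then F ⟨T p, h⟩ else 0 with hG
  have hGd : LowDistortionOn ε V G := by
    intro p hp q hq
    have h := hF ⟨T p, hmem p hp⟩ ⟨T q, hmem q hq⟩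
    rw [hiso] at h
    simp only [hG, hmem p hp, hmem q hq, dif_pos]
    exact h
  obtain ⟨W, hW1, -, hW3⟩ := hard d ε G h0.le hGd
  have hlow := (hGd 1 hV1 0 hV0).1
  have hlen : ∑ l : ι, |(1 : ι → ℝ) l - (0 : ι → ℝ) l| = (k : ℝ) ^ n := by simp [hι]
  rw [hlen] at hlow
  have hk' : (1 : ℝ) ≤ k := by exact_mod_cast hk
  have hmain := log_dim_lower_bound hd hk h0.le (by linarith) (by norm_num : (0 : ℝ) ≤ 22)
    (fun j => G 1 j - G 0 j) W hW1 hlow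
    (hW3.trans (mul_le_mul_of_nonneg_left hK (by positivity)))
  have hNpos : (0 : ℝ) < N := by exact_mod_cast (by omega : 0 < N)
  have hdpos : (0 : ℝ) < d := by exact_mod_cast hd
  have hup : Real.log N ≤ Real.log 2 + (n + 1) * Real.log (2 * k) := by
    have h2 : (N : ℝ) ≤ 2 * (2 * k) ^ (n + 1) := by exact_mod_cast hn2.le
    have := Real.log_le_log hNpos h2
    rw [Real.log_mul (by norm_num) (by positivity), Real.log_pow] at this
    exact_mod_cast this
  have hdown : n * Real.log (2 * k) ≤ Real.log N := by
    have h2 : (2 * k : ℝ) ^ n ≤ N := by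
      have : (2 * k) ^ n ≤ N := by omega
      exact_mod_cast this
    have := Real.log_le_log (by positivity) h2
    rwa [Real.log_pow] at this
  have hnL : n * L * (Real.log 2 / 3) ≤ Real.log N := by
    refine le_trans ?_ hdown
    rw [mul_assoc]
    refine mul_le_mul_of_nonneg_left ?_ (Nat.cast_nonneg n)
    linarith
  have hnL' : n * L * 0.231 ≤ Real.log N := by
    refine le_trans ?_ hnL
    gcongr
    linarith
  have hcost : 44 * n + (Real.log (2 * k) + 2 * Real.log 2) ≤ 300 / L * Real.log N := by
    rw [div_mul_eq_mul_div, le_div_iff₀ hLpos]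
    have : 0 ≤ n * L := by positivity
    nlinarith
  rw [← Real.log_le_log_iff (by positivity) hdpos, Real.log_rpow hNpos]
  linarith
end

section
/- Let k ≥ 2 and n ≥ 1 be integers, let d ≥ 1, and let ε be a real number with 0 ≤ ε < 1/(k−1). Suppose f : ([2k])^n → ℝ^d satisfies ‖f(x₁,…,xₙ)‖₁ ≤ 1 for all x₁,…,xₙ ∈ [2k], and moreover that for every ℓ ∈ [n], every x₁,…,x_{ℓ−1} ∈ [2k], and every r ∈ [k−1], one has (1/(2k))·‖ Σ_{b=1}^{r} (f̄(x₁,…,x_{ℓ−1},b) + f̄(x₁,…,x_{ℓ−1},b+k)) − Σ_{b=r+1}^{k} (f̄(x₁,…,x_{ℓ−1},b) + f̄(x₁,…,x_{ℓ−1},b+k)) ‖₁ ≥ 1 − ε, where f̄(x₁,…,x_ℓ) denotes the average of f(x₁,…,xₙ) over x_{ℓ+1},…,xₙ chosen uniformly and independently from [2k]. Then, setting δ := (k−1)ε/2, we have d ≥ 2^{(log₂ k − δ·log₂(k−1) − H(δ))·n − 1} − 1/2. -/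
/-- The binary entropy function `H(δ) = −δ log₂ δ − (1−δ) log₂ (1−δ)`
(with the convention `H(0) = 0`, which holds since `Real.logb 2 0 = 0`). -/
noncomputable def binH (p : ℝ) : ℝ :=
  -(p * Real.logb 2 p) - (1 - p) * Real.logb 2 (1 - p)

open Classical in
/-- For `f : [K]^n → ℝ^d` and a prefix `x = (x₁, …, x_ℓ)`, the average
`f̄(x₁,…,x_ℓ) = K^{−(n−ℓ)} · Σ_{x_{ℓ+1},…,x_n ∈ [K]} f(x₁,…,x_n)`,
i.e. the average of `f` over all points whose first `ℓ` coordinates agree with `x`. -/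
noncomputable def fbar {K n d : ℕ} (f : (Fin n → Fin K) → Fin d → ℝ)
    {ℓ : ℕ} (x : Fin ℓ → Fin K) : Fin d → ℝ :=
  ((K : ℝ) ^ (n - ℓ))⁻¹ •
    ∑ y : Fin n → Fin K,
      if ∀ i : Fin n, ∀ h : (i : ℕ) < ℓ, y i = x ⟨(i : ℕ), h⟩ then f y else 0

/-- If every conditional weight has total mass `c`, the product weights have total mass `c ^ n`. -/
theorem sum_prod_prefix_eq_pow {α : Type*} [Fintype α] (c : ℝ)
    (q : ∀ ℓ : ℕ, (Fin ℓ → α) → α → ℝ) (hq : ∀ ℓ x, ∑ b, q ℓ x b = c) (n : ℕ) :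
    ∑ y : Fin n → α, ∏ i : Fin n, q i (fun j => y (Fin.castLE i.isLt.le j)) (y i) = c ^ n := by
  induction n with
  | zero => simp
  | succ n ih =>
    rw [← (Fin.snocEquiv (fun _ : Fin (n + 1) => α)).sum_comp, Fintype.sum_prod_type_right,
      pow_succ, ← ih, Finset.sum_mul]
    refine Finset.sum_congr rfl fun x _ => ?_
    rw [← hq n x, Finset.mul_sum]
    refine Finset.sum_congr rfl fun b _ => ?_
    rw [Fin.prod_univ_castSucc]
    simp only [Fin.snocEquiv_apply]
    congr 1
    · refine Finset.prod_congr rfl fun i _ => ?_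
      rw [Fin.snoc_castSucc (α := fun _ => α)]
      congr 1
      funext j
      exact Fin.snoc_castSucc (α := fun _ => α) b x (Fin.castLE i.isLt.le j)
    · rw [Fin.snoc_last]
      congr 1
      funext j
      exact Fin.snoc_castSucc (α := fun _ => α) b x j

/-- Threshold decoding: if for every threshold `r` the sign of `b < r` can be predicted with
advantage `1 - ε`, then `b` can be predicted with error at most `(k - 1) ε / 2`. -/
theorem exists_decoder {S : Type*} [Fintype S] {k : ℕ} (hk : 1 ≤ k) (ε C : ℝ)
    (W : Fin k → S → ℝ) (hW : ∀ b s, 0 ≤ W b s) (htot : ∑ s, ∑ b, W b s ≤ C)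
    (hadv : ∀ r : ℕ, 1 ≤ r → r ≤ k - 1 →
      (1 - ε) * C ≤ ∑ s, |∑ b : Fin k, (if (b : ℕ) < r then (1 : ℝ) else -1) * W b s|) :
    ∃ g : S → Fin k,
      ∑ s, ∑ b, (if g s = b then 0 else W b s) ≤ ((k : ℝ) - 1) * ε / 2 * C := by
  classical
  set T : ℕ → S → ℝ := fun r s => ∑ b : Fin k, (if (b : ℕ) < r then (1 : ℝ) else -1) * W b s
    with hT
  let above : ℕ → S → Prop := fun r s => T r s < 0
  let g : S → Fin k := fun s =>
    ⟨((Finset.Icc 1 (k - 1)).filter fun r => above r s).card, by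
      have := Finset.card_filter_le (Finset.Icc 1 (k - 1)) (fun r => above r s)
      rw [Nat.card_Icc] at this
      omega⟩
  let wrong : ℕ → S → Fin k → Prop := fun r s b => ¬ (above r s ↔ r ≤ (b : ℕ))
  have hg : ∀ s b, g s ≠ b → ∃ r ∈ Finset.Icc 1 (k - 1), wrong r s b := by
    intro s b hne
    by_contra! hall
    apply hne
    apply Fin.ext
    change ((Finset.Icc 1 (k - 1)).filter fun r => above r s).card = b
    have : ((Finset.Icc 1 (k - 1)).filter fun r => above r s) = Finset.Icc 1 (b : ℕ) := by
      ext r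
      simp only [Finset.mem_filter, Finset.mem_Icc]
      have hb := b.isLt
      constructor
      · rintro ⟨hr, ha⟩
        exact ⟨hr.1, (not_not.1 (hall r (Finset.mem_Icc.2 hr))).1 ha⟩
      · rintro ⟨h1, h2⟩
        have hr : 1 ≤ r ∧ r ≤ k - 1 := ⟨h1, by omega⟩
        exact ⟨hr, (not_not.1 (hall r (Finset.mem_Icc.2 hr))).2 h2⟩
    rw [this, Nat.card_Icc]
    omega
  have hone : ∀ r s, ∑ b, (if wrong r s b then W b s else 0) = (∑ b, W b s - |T r s|) / 2 := by
    intro r s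
    by_cases ha : above r s
    · have : |T r s| = -T r s := abs_of_neg ha
      rw [this, sub_neg_eq_add, ← Finset.sum_add_distrib, Finset.sum_div]
      refine Finset.sum_congr rfl fun b _ => ?_
      simp only [wrong, ha, true_iff, not_le]
      split_ifs <;> ring
    · have : |T r s| = T r s := abs_of_nonneg (not_lt.1 ha)
      rw [this, ← Finset.sum_sub_distrib, Finset.sum_div]
      refine Finset.sum_congr rfl fun b _ => ?_
      by_cases hb : (b : ℕ) < r
      · simp [wrong, ha, hb, not_le.2 hb]
      · simp [wrong, ha, hb, not_lt.1 hb]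
  have hr : ∀ r ∈ Finset.Icc 1 (k - 1),
      ∑ s, ∑ b, (if wrong r s b then W b s else 0) ≤ ε / 2 * C := by
    intro r hr
    rw [Finset.mem_Icc] at hr
    have h := hadv r hr.1 hr.2
    simp only [hone]
    rw [← Finset.sum_div, Finset.sum_sub_distrib]
    simp only [hT]
    linarith
  refine ⟨g, ?_⟩
  calc ∑ s, ∑ b, (if g s = b then 0 else W b s)
      ≤ ∑ s, ∑ b, ∑ r ∈ Finset.Icc 1 (k - 1), (if wrong r s b then W b s else 0) := by
        refine Finset.sum_le_sum fun s _ => Finset.sum_le_sum fun b _ => ?_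
        have hnn : ∀ r ∈ Finset.Icc 1 (k - 1), 0 ≤ (if wrong r s b then W b s else 0) := by
          intro r _
          split_ifs
          exacts [hW b s, le_rfl]
        split_ifs with h
        · exact Finset.sum_nonneg hnn
        · obtain ⟨r, hr1, hr2⟩ := hg s b h
          calc W b s = if wrong r s b then W b s else 0 := by rw [if_pos hr2]
            _ ≤ _ := Finset.single_le_sum
              (f := fun r => if wrong r s b then W b s else 0) hnn hr1
    _ = ∑ r ∈ Finset.Icc 1 (k - 1), ∑ s, ∑ b, (if wrong r s b then W b s else 0) := by
        rw [Finset.sum_comm]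
        rw [Finset.sum_congr rfl fun b _ => Finset.sum_comm, Finset.sum_comm]
        exact Finset.sum_congr rfl fun r _ => Finset.sum_comm
    _ ≤ ∑ r ∈ Finset.Icc 1 (k - 1), ε / 2 * C := Finset.sum_le_sum hr
    _ = ((k : ℝ) - 1) * ε / 2 * C := by
        rw [Finset.sum_const, Nat.card_Icc, nsmul_eq_mul]
        have : ((k - 1 + 1 - 1 : ℕ) : ℝ) = (k : ℝ) - 1 := by
          rw [Nat.add_sub_cancel, Nat.cast_sub hk, Nat.cast_one]
        rw [this]
        ring

/-- Reduction of an index below `2 * k` modulo `k`. -/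
def halfRes (k a : ℕ) : ℕ := if a < k then a else a - k

theorem halfRes_lt {k a : ℕ} (ha : a < 2 * k) : halfRes k a < k := by
  unfold halfRes
  split_ifs <;> omega

theorem sum_halfRes (k : ℕ) (F : ℕ → ℝ) :
    ∑ a : Fin (2 * k), F (halfRes k a) = 2 * ∑ b ∈ Finset.range k, F b := by
  rw [Fin.sum_univ_eq_sum_range (fun a => F (halfRes k a)), two_mul, Finset.sum_range_add, two_mul]
  congr 1
  · refine Finset.sum_congr rfl fun a ha => ?_
    rw [halfRes, if_pos (Finset.mem_range.1 ha)]
  · refine Finset.sum_congr rfl fun a _ => ?_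
    rw [halfRes, if_neg (by omega), Nat.add_sub_cancel_left]

/-- The weight of a symbol in the sign-and-coordinate encoding of a vector of ℓ1 norm at most
one: a signed coordinate carries the matching part of the entry, `none` the missing mass. -/
noncomputable def symbolWeight {d : ℕ} (v : Fin d → ℝ) : Option (Fin d × Bool) → ℝ
  | none => 1 - l1norm v
  | some (j, true) => max (v j) 0
  | some (j, false) => max (-v j) 0

theorem symbolWeight_nonneg {d : ℕ} {v : Fin d → ℝ} (hv : l1norm v ≤ 1)
    (s : Option (Fin d × Bool)) : 0 ≤ symbolWeight v s := by
  match s with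
  | none => exact sub_nonneg.2 hv
  | some (j, true) => exact le_max_right _ _
  | some (j, false) => exact le_max_right _ _

theorem symbolWeight_true_sub_false {d : ℕ} (v : Fin d → ℝ) (j : Fin d) :
    symbolWeight v (some (j, true)) - symbolWeight v (some (j, false)) = v j := by
  simp only [symbolWeight]
  rcases le_total (v j) 0 with h | h
  · rw [max_eq_right h, max_eq_left (by linarith)]; ring
  · rw [max_eq_left h, max_eq_right (by linarith)]; ring

theorem sum_symbolWeight {d : ℕ} (v : Fin d → ℝ) : ∑ s, symbolWeight v s = 1 := by
  rw [Fintype.sum_option, Fintype.sum_prod_type]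
  have : ∀ j, ∑ b, symbolWeight v (some (j, b)) = |v j| := by
    intro j
    rw [Fintype.sum_bool]
    simp only [symbolWeight]
    rcases le_total (v j) 0 with h | h
    · rw [max_eq_right h, max_eq_left (by linarith), abs_of_nonpos h]; ring
    · rw [max_eq_left h, max_eq_right (by linarith), abs_of_nonneg h]; ring
  rw [Finset.sum_congr rfl fun j _ => this j, symbolWeight, l1norm, sub_add_cancel]

/-- The points of `[K]^n` whose first coordinates are given by `x`. -/
def HasPrefix {K n ℓ : ℕ} (x : Fin ℓ → Fin K) (y : Fin n → Fin K) : Prop :=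
  ∀ i : Fin n, ∀ h : (i : ℕ) < ℓ, y i = x ⟨(i : ℕ), h⟩

theorem hasPrefix_iff {K n ℓ : ℕ} (h : ℓ ≤ n) (x : Fin ℓ → Fin K) (y : Fin n → Fin K) :
    HasPrefix x y ↔ (fun j => y (Fin.castLE h j)) = x :=
  ⟨fun H => funext fun j => H (Fin.castLE h j) j.isLt,
    fun H i hi => congrFun H ⟨i, hi⟩⟩

theorem hasPrefix_snoc_iff {K n ℓ : ℕ} (h : ℓ < n) (x : Fin ℓ → Fin K) (b : Fin K)
    (y : Fin n → Fin K) :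
    HasPrefix (Fin.snoc x b : Fin (ℓ + 1) → Fin K) y ↔ HasPrefix x y ∧ y ⟨ℓ, h⟩ = b := by
  constructor
  · intro H
    refine ⟨fun i hi => ?_, ?_⟩
    · rw [H i (by omega)]
      exact Fin.snoc_castSucc (α := fun _ => Fin K) b x ⟨i, hi⟩
    · rw [H ⟨ℓ, h⟩ (Nat.lt_succ_self ℓ)]
      exact Fin.snoc_last (α := fun _ => Fin K) b x
  · rintro ⟨H, hb⟩ i hi
    by_cases hil : (i : ℕ) < ℓ
    · rw [H i hil]
      exact (Fin.snoc_castSucc (α := fun _ => Fin K) b x ⟨i, hil⟩).symm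
    · obtain rfl : i = ⟨ℓ, h⟩ := Fin.ext (by simp only; omega)
      rw [hb]
      exact (Fin.snoc_last (α := fun _ => Fin K) b x).symm

open Classical in
theorem card_hasPrefix_le {K n ℓ : ℕ} (x : Fin ℓ → Fin K) :
    (Finset.univ.filter fun y : Fin n → Fin K => HasPrefix x y).card ≤ K ^ (n - ℓ) := by
  have : K ^ (n - ℓ) = (Finset.univ : Finset (Fin (n - ℓ) → Fin K)).card := by simp
  rw [this]
  refine Finset.card_le_card_of_injOn
    (fun y j => y ⟨ℓ + j, by have := j.isLt; omega⟩) (fun _ _ => Finset.mem_univ _) ?_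
  intro y hy z hz hyz
  simp only [Finset.coe_filter, Finset.mem_univ, true_and, Set.mem_ofPred_eq] at hy hz
  funext i
  by_cases hi : (i : ℕ) < ℓ
  · rw [hy i hi, hz i hi]
  · have := congrFun hyz ⟨i - ℓ, by omega⟩
    have e : (⟨ℓ + (i - ℓ), by omega⟩ : Fin n) = i := Fin.ext (by simp only; omega)
    simpa only [e] using this

open Classical in
theorem fbar_add_fbar_apply {k n d ℓ : ℕ} (f : (Fin n → Fin (2 * k)) → Fin d → ℝ) (h : ℓ < n)
    (x : Fin ℓ → Fin (2 * k)) (b : Fin k) (h₁ : (b : ℕ) < 2 * k) (h₂ : (b : ℕ) + k < 2 * k)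
    (j : Fin d) :
    (fbar f (Fin.snoc x (⟨b, h₁⟩ : Fin (2 * k))) +
      fbar f (Fin.snoc x (⟨b + k, h₂⟩ : Fin (2 * k)))) j =
    (((2 * k : ℕ) : ℝ) ^ (n - (ℓ + 1)))⁻¹ *
      ∑ y, if HasPrefix x y ∧ halfRes k (y ⟨ℓ, h⟩) = b then f y j else 0 := by
  rw [fbar, fbar, ← smul_add, Pi.smul_apply, smul_eq_mul, ← Finset.sum_add_distrib,
    Finset.sum_apply]
  congr 1
  refine Finset.sum_congr rfl fun y _ => ?_
  have e₁ := hasPrefix_snoc_iff h x ⟨b, h₁⟩ y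
  have e₂ := hasPrefix_snoc_iff h x ⟨b + k, h₂⟩ y
  rw [HasPrefix] at e₁ e₂
  rw [if_congr e₁ rfl rfl, if_congr e₂ rfl rfl, Pi.add_apply]
  have hy := (y ⟨ℓ, h⟩).isLt
  have hb := b.isLt
  by_cases hx : HasPrefix x y
  · simp only [hx, true_and, Fin.ext_iff, halfRes]
    generalize ((y ⟨ℓ, h⟩ : Fin (2 * k)) : ℕ) = a at *
    by_cases ha : a < k
    · have : a ≠ b + k := by omega
      simp only [ha, this, if_true, if_false]
      split_ifs <;> simp
    · have h3 : a ≠ b := by omega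
      have h4 : a - k = b ↔ a = b + k := by omega
      simp only [ha, h3, h4, if_false]
      split_ifs <;> simp
  · simp [hx]

open Classical in
theorem exists_prefix_decoder {k n d : ℕ} (hk : 1 ≤ k) (ε : ℝ)
    (f : (Fin n → Fin (2 * k)) → Fin d → ℝ) (hnorm : ∀ x, l1norm (f x) ≤ 1)
    {ℓ : ℕ} (h : ℓ < n) (x : Fin ℓ → Fin (2 * k))
    (h₁ : ∀ b : Fin k, (b : ℕ) < 2 * k) (h₂ : ∀ b : Fin k, (b : ℕ) + k < 2 * k)
    (hadv : ∀ r : ℕ, 1 ≤ r → r ≤ k - 1 →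
      1 - ε ≤ (1 / (2 * (k : ℝ))) * l1norm
        (∑ b : Fin k, (if (b : ℕ) < r then (1 : ℝ) else -1) •
          (fbar f (Fin.snoc x (⟨b, h₁ b⟩ : Fin (2 * k))) +
           fbar f (Fin.snoc x (⟨b + k, h₂ b⟩ : Fin (2 * k)))))) :
    ∃ g : Option (Fin d × Bool) → Fin k,
      ∑ y, (if HasPrefix x y then
        ∑ s, (if (g s : ℕ) = halfRes k (y ⟨ℓ, h⟩) then 0 else symbolWeight (f y) s) else 0)
        ≤ ((k : ℝ) - 1) * ε / 2 * ((2 * k : ℕ) : ℝ) ^ (n - ℓ) := by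
  have hK : (0 : ℝ) < ((2 * k : ℕ) : ℝ) := by exact_mod_cast (by omega : 0 < 2 * k)
  let W : Fin k → Option (Fin d × Bool) → ℝ := fun b s =>
    ∑ y, if HasPrefix x y ∧ halfRes k (y ⟨ℓ, h⟩) = b then symbolWeight (f y) s else 0
  have sum_res : ∀ (y : Fin n → Fin (2 * k)) (F : Fin k → ℝ),
      ∑ b : Fin k, (if HasPrefix x y ∧ halfRes k (y ⟨ℓ, h⟩) = b then F b else 0) =
        if HasPrefix x y then F ⟨halfRes k (y ⟨ℓ, h⟩), halfRes_lt (y ⟨ℓ, h⟩).isLt⟩ else 0 := by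
    intro y F
    by_cases hx : HasPrefix x y
    · simp only [hx, true_and, if_true]
      rw [Finset.sum_eq_single ⟨halfRes k (y ⟨ℓ, h⟩), halfRes_lt (y ⟨ℓ, h⟩).isLt⟩]
      · simp
      · intro b _ hb
        rw [if_neg]
        intro e
        exact hb (Fin.ext e.symm)
      · simp
    · simp [hx]
  have htot : ∑ s, ∑ b, W b s ≤ ((2 * k : ℕ) : ℝ) ^ (n - ℓ) := by
    calc ∑ s, ∑ b, W b s
        = ∑ s, ∑ y, if HasPrefix x y then symbolWeight (f y) s else 0 := by
          refine Finset.sum_congr rfl fun s _ => ?_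
          simp only [W]
          rw [Finset.sum_comm]
          exact Finset.sum_congr rfl fun y _ => sum_res y fun _ => symbolWeight (f y) s
      _ = ∑ y, if HasPrefix x y then (1 : ℝ) else 0 := by
          rw [Finset.sum_comm]
          refine Finset.sum_congr rfl fun y _ => ?_
          split_ifs
          · exact sum_symbolWeight _
          · simp
      _ ≤ ((2 * k : ℕ) : ℝ) ^ (n - ℓ) := by
          rw [Finset.sum_boole]
          exact_mod_cast card_hasPrefix_le (n := n) x
  obtain ⟨g, hg⟩ := exists_decoder hk ε (((2 * k : ℕ) : ℝ) ^ (n - ℓ)) W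
    (fun b s => Finset.sum_nonneg fun y _ => by
      split_ifs
      exacts [symbolWeight_nonneg (hnorm y) s, le_rfl]) htot (by
    intro r h1 h2
    have hr := hadv r h1 h2
    have hpow : ((2 * k : ℕ) : ℝ) ^ (n - ℓ) =
        (2 * (k : ℝ)) * ((2 * k : ℕ) : ℝ) ^ (n - (ℓ + 1)) := by
      rw [show n - ℓ = n - (ℓ + 1) + 1 by omega, pow_succ]
      push_cast
      ring
    have hW : ∀ (b : Fin k) (j : Fin d), (∑ y, if HasPrefix x y ∧ halfRes k (y ⟨ℓ, h⟩) = b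
        then f y j else 0) = W b (some (j, true)) - W b (some (j, false)) := by
      intro b j
      simp only [W]
      rw [← Finset.sum_sub_distrib]
      refine Finset.sum_congr rfl fun y _ => ?_
      split_ifs
      · rw [symbolWeight_true_sub_false]
      · simp
    set P := ((2 * k : ℕ) : ℝ) ^ (n - (ℓ + 1)) with hP
    have hPpos : 0 < P := pow_pos hK _
    set T : Option (Fin d × Bool) → ℝ := fun s =>
      ∑ b : Fin k, (if (b : ℕ) < r then (1 : ℝ) else -1) * W b s with hT
    have hnormeq : l1norm
        (∑ b : Fin k, (if (b : ℕ) < r then (1 : ℝ) else -1) •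
          (fbar f (Fin.snoc x (⟨b, h₁ b⟩ : Fin (2 * k))) +
           fbar f (Fin.snoc x (⟨b + k, h₂ b⟩ : Fin (2 * k))))) =
        P⁻¹ * ∑ j, |T (some (j, true)) - T (some (j, false))| := by
      rw [l1norm, Finset.mul_sum]
      refine Finset.sum_congr rfl fun j _ => ?_
      rw [show ∀ u : ℝ, P⁻¹ * |u| = |P⁻¹ * u| from fun u => by
        rw [abs_mul, abs_of_pos (inv_pos.2 hPpos)]]
      congr 1
      simp only [hT]
      rw [Finset.sum_apply, ← Finset.sum_sub_distrib, Finset.mul_sum]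
      refine Finset.sum_congr rfl fun b _ => ?_
      rw [Pi.smul_apply, smul_eq_mul, fbar_add_fbar_apply f h x b, hW]
      ring
    have htri : ∑ j, |T (some (j, true)) - T (some (j, false))| ≤ ∑ s, |T s| := by
      rw [Fintype.sum_option, Fintype.sum_prod_type]
      refine le_trans (Finset.sum_le_sum fun j _ => ?_) (le_add_of_nonneg_left (abs_nonneg _))
      rw [Fintype.sum_bool]
      exact abs_sub _ _
    rw [hnormeq] at hr
    have hkpos : (0 : ℝ) < 2 * (k : ℝ) := by exact_mod_cast hK
    rw [hpow]
    calc (1 - ε) * (2 * (k : ℝ) * P)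
        ≤ (1 / (2 * (k : ℝ)) * (P⁻¹ * ∑ j, |T (some (j, true)) - T (some (j, false))|)) *
          (2 * (k : ℝ) * P) := mul_le_mul_of_nonneg_right hr (by positivity)
      _ = ∑ j, |T (some (j, true)) - T (some (j, false))| := by field_simp
      _ ≤ _ := htri)
  refine ⟨g, le_of_eq_of_le ?_ hg⟩
  simp only [W]
  have : ∀ s, ∑ b : Fin k, (if g s = b then (0 : ℝ) else
      ∑ y, if HasPrefix x y ∧ halfRes k (y ⟨ℓ, h⟩) = b then symbolWeight (f y) s else 0) =
      ∑ y, if HasPrefix x y then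
        (if (g s : ℕ) = halfRes k (y ⟨ℓ, h⟩) then 0 else symbolWeight (f y) s) else 0 := by
    intro s
    have hy : ∀ y, (if HasPrefix x y then
        (if (g s : ℕ) = halfRes k (y ⟨ℓ, h⟩) then 0 else symbolWeight (f y) s) else 0) =
        ∑ b : Fin k, if HasPrefix x y ∧ halfRes k (y ⟨ℓ, h⟩) = b then
          (if g s = b then 0 else symbolWeight (f y) s) else 0 := by
      intro y
      rw [sum_res y fun b => if g s = b then 0 else symbolWeight (f y) s]
      simp only [Fin.ext_iff]
    rw [Finset.sum_congr rfl fun y _ => hy y, Finset.sum_comm]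
    refine Finset.sum_congr rfl fun b _ => ?_
    by_cases hb : g s = b <;> simp [hb]
  simp only [this]
  rw [Finset.sum_comm]
  refine Finset.sum_congr rfl fun y _ => ?_
  split_ifs <;> simp

/-- A message with `card S` possible values that allows every coordinate of a uniform point of
`[2k]^n` to be predicted modulo `k` from the preceding ones, with error at most `δ`, satisfies
the Fano-type bound `n (log k - δ log (k - 1) - h(δ)) ≤ log (card S)`. -/
theorem mul_le_log_card_of_decoder {S : Type*} [Fintype S] [Nonempty S] {k n : ℕ} (hk : 2 ≤ k)
    {δ : ℝ} (hδ0 : 0 < δ) (hδ1 : δ ≤ 1 / 2) (p : (Fin n → Fin (2 * k)) → S → ℝ)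
    (hp : ∀ y s, 0 ≤ p y s) (hp1 : ∀ y, ∑ s, p y s = 1)
    (g : ∀ ℓ : ℕ, (Fin ℓ → Fin (2 * k)) → S → Fin k)
    (hg : ∀ i : Fin n, ∑ y, ∑ s,
      (if (g i (fun j => y (Fin.castLE i.isLt.le j)) s : ℕ) = halfRes k (y i) then 0
        else p y s) ≤ δ * ((2 * k : ℕ) : ℝ) ^ n) :
    n * (Real.log k - δ * Real.log ((k : ℝ) - 1) - Real.binEntropy δ) ≤
      Real.log (Fintype.card S : ℝ) := by
  have hk2 : (2 : ℝ) ≤ k := by exact_mod_cast hk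
  have hk1 : (0 : ℝ) < (k : ℝ) - 1 := by linarith
  have hk0 : (0 : ℝ) < k := by linarith
  have hc : (0 : ℝ) < (Fintype.card S : ℝ) := by exact_mod_cast Fintype.card_pos
  set c : ℝ := (Fintype.card S : ℝ)
  set N : ℝ := ((2 * k : ℕ) : ℝ) ^ n with hN
  have hNpos : 0 < N := pow_pos (by exact_mod_cast (by omega : 0 < 2 * k)) _
  set A : ℝ := k * (1 - δ) with hA
  set B : ℝ := k * (δ / (k - 1)) with hB
  have hApos : 0 < A := mul_pos hk0 (by linarith)
  have hBpos : 0 < B := mul_pos hk0 (div_pos hδ0 hk1)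
  have hBA : B ≤ A := by
    refine mul_le_mul_of_nonneg_left ?_ hk0.le
    rw [div_le_iff₀ hk1]
    nlinarith
  let q : S → ∀ ℓ : ℕ, (Fin ℓ → Fin (2 * k)) → Fin (2 * k) → ℝ := fun s ℓ x a =>
    if (g ℓ x s : ℕ) = halfRes k a then A else B
  let Z : (Fin n → Fin (2 * k)) → S → ℝ := fun y s =>
    ∏ i : Fin n, q s i (fun j => y (Fin.castLE i.isLt.le j)) (y i)
  have hqpos : ∀ s ℓ x a, 0 < q s ℓ x a := by
    intro s ℓ x a
    simp only [q]
    split_ifs <;> assumption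
  have hZpos : ∀ y s, 0 < Z y s := fun y s => Finset.prod_pos fun i _ => hqpos _ _ _ _
  have hq : ∀ s ℓ x, ∑ a, q s ℓ x a = ((2 * k : ℕ) : ℝ) := by
    intro s ℓ x
    simp only [q]
    rw [sum_halfRes k fun b => if (g ℓ x s : ℕ) = b then A else B]
    have : ∀ b, (if (g ℓ x s : ℕ) = b then A else B) =
        (if (g ℓ x s : ℕ) = b then A - B else 0) + B := by
      intro b
      split_ifs <;> ring
    simp only [this]
    rw [Finset.sum_add_distrib, Finset.sum_ite_eq, if_pos (Finset.mem_range.2 (g ℓ x s).isLt),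
      Finset.sum_const, Finset.card_range, nsmul_eq_mul, hA, hB]
    push_cast
    field_simp
    ring
  have hZsum : ∀ s, ∑ y, Z y s = N := fun s => sum_prod_prefix_eq_pow _ (q s) (hq s) n
  have hple : ∀ y s, p y s ≤ 1 := fun y s => by
    rw [← hp1 y]
    exact Finset.single_le_sum (fun s _ => hp y s) (Finset.mem_univ s)
  have hmass : ∑ y, ∑ s, p y s = N := by
    simp only [hp1]
    simp [hN]
  have hupper : ∑ y, ∑ s, p y s * Real.log (Z y s) ≤ N * Real.log c := by
    calc ∑ y, ∑ s, p y s * Real.log (Z y s)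
        ≤ ∑ y, ∑ s, (Z y s / c + p y s * (Real.log c - 1)) := by
          refine Finset.sum_le_sum fun y _ => Finset.sum_le_sum fun s _ => ?_
          have h1 := Real.log_le_sub_one_of_pos (div_pos (hZpos y s) hc)
          rw [Real.log_div (hZpos y s).ne' hc.ne'] at h1
          have h2 : p y s * (Z y s / c) ≤ Z y s / c :=
            mul_le_of_le_one_left (div_pos (hZpos y s) hc).le (hple y s)
          have h3 := mul_le_mul_of_nonneg_left h1 (hp y s)
          linarith
      _ = N * Real.log c := by
          simp only [Finset.sum_add_distrib, ← Finset.sum_mul, hmass, ← Finset.sum_div]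
          rw [Finset.sum_comm]
          simp only [hZsum, Finset.sum_const, nsmul_eq_mul, Finset.card_univ]
          change c * N / c + _ = _
          field_simp
          ring
  have hlower : n * (N * (Real.log A - δ * (Real.log A - Real.log B))) ≤
      ∑ y, ∑ s, p y s * Real.log (Z y s) := by
    have hlog : ∀ y s, p y s * Real.log (Z y s) = ∑ i : Fin n, (p y s * Real.log A -
        (if (g i (fun j => y (Fin.castLE i.isLt.le j)) s : ℕ) = halfRes k (y i) then 0
        else p y s) * (Real.log A - Real.log B)) := by
      intro y s
      rw [Real.log_prod fun i _ => (hqpos _ _ _ _).ne', Finset.mul_sum]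
      refine Finset.sum_congr rfl fun i _ => ?_
      simp only [q]
      split_ifs <;> ring
    have hswap : ∑ y, ∑ s, p y s * Real.log (Z y s) = ∑ i : Fin n, (N * Real.log A -
        (∑ y, ∑ s, (if (g i (fun j => y (Fin.castLE i.isLt.le j)) s : ℕ) = halfRes k (y i)
          then 0 else p y s)) * (Real.log A - Real.log B)) := by
      simp only [hlog]
      rw [Finset.sum_congr rfl fun y _ => Finset.sum_comm, Finset.sum_comm]
      refine Finset.sum_congr rfl fun i _ => ?_
      simp only [Finset.sum_sub_distrib, ← Finset.sum_mul, hmass]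
    have hlogBA : 0 ≤ Real.log A - Real.log B := sub_nonneg.2 (Real.log_le_log hBpos hBA)
    rw [hswap]
    calc _ = ∑ i : Fin n, (N * (Real.log A - δ * (Real.log A - Real.log B))) := by simp
      _ ≤ _ := Finset.sum_le_sum fun i _ => by
          have := mul_le_mul_of_nonneg_right (hg i) hlogBA
          linarith
  have hrate : Real.log A - δ * (Real.log A - Real.log B) =
      Real.log k - δ * Real.log ((k : ℝ) - 1) - Real.binEntropy δ := by
    rw [hA, hB, Real.log_mul hk0.ne' (by linarith), Real.log_mul hk0.ne' (div_pos hδ0 hk1).ne',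
      Real.log_div hδ0.ne' hk1.ne', Real.binEntropy, Real.log_inv, Real.log_inv]
    ring
  rw [hrate] at hlower
  refine le_of_mul_le_mul_left ?_ hNpos
  linarith

theorem binH_eq (p : ℝ) : binH p = Real.binEntropy p / Real.log 2 := by
  rw [binH, Real.binEntropy, Real.log_inv, Real.log_inv, Real.logb, Real.logb]
  ring

/-- Main technical theorem: if `f : [2k]^n → ℝ^d` has `‖f(x)‖₁ ≤ 1` everywhere and
satisfies, for every `ℓ ∈ [n]`, every prefix `x₁,…,x_{ℓ−1} ∈ [2k]` and every `r ∈ [k−1]`,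
`(1/(2k))·‖ Σ_{b=1}^r (f̄(x…,b) + f̄(x…,b+k)) − Σ_{b=r+1}^k (f̄(x…,b) + f̄(x…,b+k)) ‖₁ ≥ 1−ε`
with `0 ≤ ε < 1/(k−1)`, then `d ≥ 2^{(log₂ k − δ log₂(k−1) − H(δ))n − 1} − 1/2`
where `δ = (k−1)ε/2`. Here elements of `[2k] = {1,…,2k}` are represented by `Fin (2k)`
with `b ∈ {1,…,k}` corresponding to the index `b−1` and `b+k` to the index `b−1+k`,
and the prefix of length `ℓ−1` is quantified as a prefix of length `ℓ < n`. -/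
theorem main_technical_theorem (k n d : ℕ) (hk : 2 ≤ k) (hn : 1 ≤ n) (hd : 1 ≤ d)
    (ε : ℝ) (hε0 : 0 ≤ ε) (hε : ε < 1 / ((k : ℝ) - 1))
    (f : (Fin n → Fin (2 * k)) → Fin d → ℝ)
    (hnorm : ∀ x, l1norm (f x) ≤ 1)
    (hconstr : ∀ ℓ : ℕ, ℓ < n → ∀ x : Fin ℓ → Fin (2 * k), ∀ r : ℕ, 1 ≤ r → r ≤ k - 1 →
      1 - ε ≤ (1 / (2 * (k : ℝ))) * l1norm
        (∑ b : Fin k, (if (b : ℕ) < r then (1 : ℝ) else -1) •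
          (fbar f (Fin.snoc x (⟨(b : ℕ), by have := b.isLt; omega⟩ : Fin (2 * k))) +
           fbar f (Fin.snoc x (⟨(b : ℕ) + k, by have := b.isLt; omega⟩ : Fin (2 * k)))))) :
    (2 : ℝ) ^ ((Real.logb 2 k - ((k : ℝ) - 1) * ε / 2 * Real.logb 2 ((k : ℝ) - 1)
        - binH (((k : ℝ) - 1) * ε / 2)) * n - 1) - 1 / 2 ≤ (d : ℝ) := by
  classical
  have hk2 : (2 : ℝ) ≤ k := by exact_mod_cast hk
  have hk1 : (0 : ℝ) < (k : ℝ) - 1 := by linarith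
  set δ : ℝ := ((k : ℝ) - 1) * ε / 2 with hδ
  have hδ0 : 0 ≤ δ := by positivity
  have hδ1 : δ < 1 / 2 := by
    rw [lt_div_iff₀ hk1] at hε
    rw [hδ]
    linarith
  have hdec : ∀ (ℓ : ℕ) (x : Fin ℓ → Fin (2 * k)), ∃ g : Option (Fin d × Bool) → Fin k,
      ∀ h : ℓ < n, ∑ y, (if HasPrefix x y then
        ∑ s, (if (g s : ℕ) = halfRes k (y ⟨ℓ, h⟩) then 0 else symbolWeight (f y) s) else 0)
        ≤ δ * ((2 * k : ℕ) : ℝ) ^ (n - ℓ) := by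
    intro ℓ x
    by_cases h : ℓ < n
    · obtain ⟨g, hg⟩ := exists_prefix_decoder (by omega) ε f hnorm h x _ _ (hconstr ℓ h x)
      exact ⟨g, fun _ => hg⟩
    · exact ⟨fun _ => ⟨0, by omega⟩, fun h' => absurd h' h⟩
  choose g hg using hdec
  have herr : ∀ i : Fin n, ∑ y, ∑ s,
      (if (g i (fun j => y (Fin.castLE i.isLt.le j)) s : ℕ) = halfRes k (y i) then 0
        else symbolWeight (f y) s) ≤ δ * ((2 * k : ℕ) : ℝ) ^ n := by
    intro i
    calc ∑ y, ∑ s, (if (g i (fun j => y (Fin.castLE i.isLt.le j)) s : ℕ) = halfRes k (y i) then 0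
          else symbolWeight (f y) s)
        = ∑ x : Fin i → Fin (2 * k), ∑ y, (if HasPrefix x y then
          ∑ s, (if (g i x s : ℕ) = halfRes k (y i) then 0 else symbolWeight (f y) s)
          else 0) := by
          symm
          rw [Finset.sum_comm]
          refine Finset.sum_congr rfl fun y _ => ?_
          simp only [hasPrefix_iff i.isLt.le]
          rw [Finset.sum_ite_eq, if_pos (Finset.mem_univ _)]
      _ ≤ ∑ x : Fin i → Fin (2 * k), δ * ((2 * k : ℕ) : ℝ) ^ (n - (i : ℕ)) :=
          Finset.sum_le_sum fun x _ => hg i x i.isLt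
      _ = δ * ((2 * k : ℕ) : ℝ) ^ n := by
          rw [Finset.sum_const, nsmul_eq_mul, Finset.card_univ, Fintype.card_fun, Fintype.card_fin,
            Fintype.card_fin, Nat.cast_pow, mul_left_comm, ← pow_add,
            Nat.add_sub_cancel' i.isLt.le]
  have hcard : (Fintype.card (Option (Fin d × Bool)) : ℝ) = 2 * d + 1 := by
    simp
    ring
  have hev : ∀ᶠ t in nhdsWithin δ (Set.Ioi δ),
      n * (Real.log k - t * Real.log ((k : ℝ) - 1) - Real.binEntropy t) ≤
        Real.log (2 * d + 1) := by
    filter_upwards [Ioo_mem_nhdsGT hδ1] with t ht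
    rw [← hcard]
    refine mul_le_log_card_of_decoder hk (hδ0.trans_lt ht.1) ht.2.le
      (fun y => symbolWeight (f y)) (fun y s => symbolWeight_nonneg (hnorm y) s)
      (fun y => sum_symbolWeight _) g fun i => (herr i).trans ?_
    exact mul_le_mul_of_nonneg_right ht.1.le (by positivity)
  have hcont : Continuous fun t : ℝ =>
      n * (Real.log k - t * Real.log ((k : ℝ) - 1) - Real.binEntropy t) := by
    have := Real.binEntropy_continuous
    fun_prop
  have hmain : n * (Real.log k - δ * Real.log ((k : ℝ) - 1) - Real.binEntropy δ) ≤
      Real.log (2 * d + 1) :=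
    le_of_tendsto (hcont.tendsto δ |>.mono_left nhdsWithin_le_nhds) hev
  have hlog2 : 0 < Real.log 2 := Real.log_pos one_lt_two
  have hexp : (2 : ℝ) ^ ((Real.logb 2 k - δ * Real.logb 2 ((k : ℝ) - 1) - binH δ) * n) ≤
      2 * d + 1 := by
    rw [← Real.le_logb_iff_rpow_le one_lt_two (by positivity), binH_eq, Real.logb, Real.logb,
      Real.logb, le_div_iff₀ hlog2]
    refine le_of_eq_of_le ?_ hmain
    field_simp
  rw [Real.rpow_sub_one two_ne_zero]
  linarith
end

section
/- Let k ≥ 2 and d ≥ 1 be integers and let 0 ≤ ε < 1/(k−1). Let A and B be two random variables such that A is uniformly distributed over [2k] and, for each a ∈ [2k], conditioned on A = a, B is distributed over [d] according to a probability distribution P_a (viewed as a nonnegative vector in ℝ^d with coordinates summing to 1). Assume that for all r ∈ [k−1], (1/(2k))·‖ Σ_{a=1}^{r} (P_a + P_{a+k}) − Σ_{a=r+1}^{k} (P_a + P_{a+k}) ‖₁ ≥ 1 − ε. Then, with δ := (k−1)ε/2, the mutual information satisfies I(A : B) ≥ log₂ k − δ·log₂(k−1) − H(δ). -/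
/-- Shannon entropy (base 2) of a finitely supported probability vector `q`:
`H(q) = −Σ_i q i · log₂ (q i)`. -/
noncomputable def shannonEntropy {α : Type*} [Fintype α] (q : α → ℝ) : ℝ :=
  -∑ i, q i * Real.logb 2 (q i)

/-- Mutual information `I(A:B) = H(A) + H(B) − H(A,B)` of a joint probability
distribution `q` of a pair `(A, B)`. -/
noncomputable def mutualInfo {α β : Type*} [Fintype α] [Fintype β] (q : α × β → ℝ) : ℝ :=
  shannonEntropy (fun a => ∑ b, q (a, b)) + shannonEntropy (fun b => ∑ a, q (a, b))
    - shannonEntropy q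

/-- Pointwise form of Gibbs' inequality. -/
lemma mul_logb_two_sub_le {x y : ℝ} (hx : 0 ≤ x) (hy : 0 ≤ y) (hxy : y = 0 → x = 0) :
    (x - y) / Real.log 2 ≤ x * Real.logb 2 x - x * Real.logb 2 y := by
  have hl : 0 < Real.log 2 := Real.log_pos one_lt_two
  have key : x - y ≤ x * Real.log x - x * Real.log y := by
    rcases hx.eq_or_lt with rfl | hx
    · simpa using hy
    · have hy' : 0 < y := lt_of_le_of_ne hy fun h => hx.ne' (hxy h.symm)
      have h := mul_le_mul_of_nonneg_left (Real.log_le_sub_one_of_pos (div_pos hy' hx)) hx.le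
      rw [Real.log_div hy'.ne' hx.ne', mul_sub, mul_sub, mul_div_cancel₀ _ hx.ne'] at h
      linarith
  calc (x - y) / Real.log 2 ≤ (x * Real.log x - x * Real.log y) / Real.log 2 := by gcongr
    _ = _ := by simp only [Real.logb]; ring

/-- The conditional entropy `H(A | B)` is at most the cross entropy with respect to any
conditional distribution `v` of `A` given `B`. -/
lemma sum_mul_logb_le_entropy_sub {α β : Type*} [Fintype α] [Fintype β]
    (q v : α × β → ℝ) (hq : ∀ z, 0 ≤ q z) (hv : ∀ z, 0 ≤ v z)
    (hv1 : ∀ b, ∑ a, v (a, b) = 1) (hqv : ∀ z, v z = 0 → q z = 0) :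
    ∑ z, q z * Real.logb 2 (v z) ≤
      shannonEntropy (fun b => ∑ a, q (a, b)) - shannonEntropy q := by
  have hs : ∀ b, 0 ≤ ∑ a, q (a, b) := fun b => Finset.sum_nonneg fun a _ => hq _
  have hs0 : ∀ a b, ∑ a, q (a, b) = 0 → q (a, b) = 0 := fun a b h =>
    (Finset.sum_eq_zero_iff_of_nonneg fun a _ => hq _).1 h a (Finset.mem_univ a)
  have key : ∀ b, ∑ a, q (a, b) * Real.logb 2 (v (a, b)) ≤
      ∑ a, q (a, b) * Real.logb 2 (q (a, b)) -
        (∑ a, q (a, b)) * Real.logb 2 (∑ a, q (a, b)) := by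
    intro b
    set s := ∑ a, q (a, b) with hsdef
    have h : ∀ a, (q (a, b) - v (a, b) * s) / Real.log 2 ≤
        q (a, b) * Real.logb 2 (q (a, b)) - q (a, b) * Real.logb 2 s
          - q (a, b) * Real.logb 2 (v (a, b)) := by
      intro a
      have h0 : v (a, b) * s = 0 → q (a, b) = 0 := fun h =>
        (mul_eq_zero.1 h).elim (hqv _) (hs0 a b)
      have h1 := mul_logb_two_sub_le (hq (a, b)) (mul_nonneg (hv (a, b)) (hs b)) h0
      rcases eq_or_ne (q (a, b)) 0 with hz | hz
      · simpa [hz] using h1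
      · rw [Real.logb_mul (fun h => hz (hqv _ h)) (fun h => hz (hs0 a b h))] at h1
        linarith
    have hsum := Finset.sum_le_sum fun a (_ : a ∈ Finset.univ) => h a
    rw [← Finset.sum_div, Finset.sum_sub_distrib, ← Finset.sum_mul, hv1, ← hsdef, one_mul,
      sub_self, zero_div, Finset.sum_sub_distrib, Finset.sum_sub_distrib, ← Finset.sum_mul,
      ← hsdef] at hsum
    linarith
  have hsum := Finset.sum_le_sum fun b (_ : b ∈ Finset.univ) => key b
  rw [Finset.sum_sub_distrib] at hsum
  simp only [shannonEntropy, Fintype.sum_prod_type_right]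
  linarith

/-- The sum over all cuts of the smaller part of a nonnegative sequence bounds the total weight
outside a median of the sequence. -/
lemma exists_sub_le_sum_cuts (k : ℕ) (hk : 1 ≤ k) (w : ℕ → ℝ) (hw : ∀ i, 0 ≤ w i) :
    ∃ m < k, ∑ i ∈ Finset.range k, w i - w m ≤
      ∑ r ∈ Finset.Icc 1 (k - 1), (∑ i ∈ Finset.range k, w i -
        |2 * ∑ i ∈ Finset.range r, w i - ∑ i ∈ Finset.range k, w i|) / 2 := by
  classical
  set W := ∑ i ∈ Finset.range k, w i with hW
  set L : ℕ → ℝ := fun r => ∑ i ∈ Finset.range r, w i with hL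
  have hW0 : 0 ≤ W := Finset.sum_nonneg fun i _ => hw i
  have hL0 : ∀ r, 0 ≤ L r := fun r => Finset.sum_nonneg fun i _ => hw i
  have hLW : ∀ r ≤ k, L r ≤ W := fun r hr =>
    Finset.sum_le_sum_of_subset_of_nonneg (Finset.range_subset_range.2 hr) fun i _ _ => hw i
  have hex : ∃ m, W ≤ 2 * L (m + 1) := by
    refine ⟨k - 1, ?_⟩
    rw [Nat.sub_add_cancel hk]
    change W ≤ 2 * W
    linarith
  have hfind := Nat.find_spec hex
  have hmk : Nat.find hex < k := by
    have : Nat.find hex ≤ k - 1 := Nat.find_min' hex (by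
      rw [Nat.sub_add_cancel hk]
      change W ≤ 2 * W
      linarith)
    omega
  have hmin : 2 * L (Nat.find hex) ≤ W := by
    rcases Nat.eq_zero_or_pos (Nat.find hex) with h | h
    · rw [h]; simpa [hL] using hW0
    · have := Nat.find_min hex (Nat.sub_one_lt_of_lt h)
      rw [Nat.sub_add_cancel h] at this
      exact (not_le.1 this).le
  generalize Nat.find hex = m at hfind hmk hmin
  refine ⟨m, hmk, ?_⟩
  set g : ℕ → ℝ := fun r => (W - |2 * L r - W|) / 2 with hg
  have hg0 : ∀ r ∈ Finset.range (k + 1), 0 ≤ g r := by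
    intro r hr
    have h1 := hLW r (Nat.lt_succ_iff.1 (Finset.mem_range.1 hr))
    have h2 := hL0 r
    have : |2 * L r - W| ≤ W := abs_le.2 ⟨by linarith, by linarith⟩
    simp only [hg]
    linarith
  have hext : ∑ r ∈ Finset.Icc 1 (k - 1), g r = ∑ r ∈ Finset.range (k + 1), g r := by
    refine Finset.sum_subset (fun r hr => ?_) fun r hr hr' => ?_
    · simp only [Finset.mem_Icc, Finset.mem_range] at *; omega
    · have : r = 0 ∨ r = k := by
        simp only [Finset.mem_Icc, Finset.mem_range] at *; omega
      rcases this with rfl | rfl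
      · simp [hg, hL, abs_of_nonneg hW0]
      · have : 2 * L r - W = W := by simp only [hL, ← hW]; ring
        simp [hg, this, abs_of_nonneg hW0]
  have hpair : g m + g (m + 1) ≤ ∑ r ∈ Finset.range (k + 1), g r := by
    rw [← Finset.sum_pair (f := g) (Nat.lt_succ_self m).ne]
    refine Finset.sum_le_sum_of_subset_of_nonneg (fun r hr => ?_) fun r hr _ => hg0 r hr
    simp only [Finset.mem_insert, Finset.mem_singleton, Finset.mem_range] at *
    omega
  have hgm : g m = L m := by
    simp only [hg]; rw [abs_of_nonpos (by linarith)]; ring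
  have hgm1 : g (m + 1) = W - L (m + 1) := by
    simp only [hg]; rw [abs_of_nonneg (by linarith)]; ring
  have hsucc : L (m + 1) = L m + w m := Finset.sum_range_succ w m
  change W - w m ≤ ∑ r ∈ Finset.Icc 1 (k - 1), g r
  rw [hext]
  linarith

lemma Fin.sum_univ_two_mul_eq {M : Type*} [AddCommMonoid M] (k : ℕ) (F : Fin (2 * k) → M) :
    ∑ a, F a = ∑ a : Fin k, (F ⟨(a : ℕ), by have := a.isLt; omega⟩ +
      F ⟨(a : ℕ) + k, by have := a.isLt; omega⟩) := by
  have h : k + k = 2 * k := (two_mul k).symm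
  rw [← Equiv.sum_comp (finCongr h) F, Fin.sum_univ_add, ← Finset.sum_add_distrib]
  refine Finset.sum_congr rfl fun a _ => ?_
  congr 2
  ext
  simp [add_comm]

lemma sum_range_sign_mul (k r : ℕ) (hr : r ≤ k) (w : ℕ → ℝ) :
    ∑ i ∈ Finset.range k, (if i < r then (1 : ℝ) else -1) * w i =
      2 * ∑ i ∈ Finset.range r, w i - ∑ i ∈ Finset.range k, w i := by
  have h : ∑ i ∈ Finset.range r, w i = ∑ i ∈ Finset.range k, if i < r then w i else 0 := by
    rw [← Finset.sum_filter]
    congr 1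
    ext i
    simp only [Finset.mem_filter, Finset.mem_range]
    omega
  rw [h, Finset.mul_sum, ← Finset.sum_sub_distrib]
  refine Finset.sum_congr rfl fun i _ => ?_
  split_ifs <;> ring

lemma Fin.sum_ite_val_eq {k m : ℕ} (hm : m < k) (x y : ℝ) :
    ∑ a : Fin k, (if (a : ℕ) = m then x else y) = x + (k - 1) * y := by
  have h : ∀ a : Fin k, (if (a : ℕ) = m then x else y) =
      (if a = ⟨m, hm⟩ then x - y else 0) + y := by
    intro a
    simp only [Fin.ext_iff]
    split_ifs <;> ring
  simp only [h, Finset.sum_add_distrib, Finset.sum_ite_eq', Finset.mem_univ, if_true,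
    Finset.sum_const, Finset.card_univ, Fintype.card_fin, nsmul_eq_mul]
  ring

/-- Main lemma: let `A` be uniform on `[2k]` and, conditioned on `A = a`, let `B` be
distributed on `[d]` according to a probability distribution `P a`, so the joint
distribution is `(a, j) ↦ (1/(2k))·P a j`. If for all `r ∈ [k−1]`,
`(1/(2k))·‖ Σ_{a=1}^r (P_a + P_{a+k}) − Σ_{a=r+1}^k (P_a + P_{a+k}) ‖₁ ≥ 1−ε`,
with `0 ≤ ε < 1/(k−1)`, then `I(A:B) ≥ log₂ k − δ log₂(k−1) − H(δ)` where `δ = (k−1)ε/2`.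
Here `[2k]` is represented by `Fin (2k)` with `a ∈ {1,…,k}` corresponding to the index
`a−1` and `a+k` to the index `a−1+k`. -/
theorem mutual_information_lower_bound (k d : ℕ) (hk : 2 ≤ k) (hd : 1 ≤ d)
    (ε : ℝ) (hε0 : 0 ≤ ε) (hε : ε < 1 / ((k : ℝ) - 1))
    (P : Fin (2 * k) → Fin d → ℝ)
    (hP0 : ∀ a j, 0 ≤ P a j) (hP1 : ∀ a, ∑ j, P a j = 1)
    (hsep : ∀ r : ℕ, 1 ≤ r → r ≤ k - 1 →
      1 - ε ≤ (1 / (2 * (k : ℝ))) * l1norm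
        (∑ a : Fin k, (if (a : ℕ) < r then (1 : ℝ) else -1) •
          (P (⟨(a : ℕ), by have := a.isLt; omega⟩ : Fin (2 * k)) +
           P (⟨(a : ℕ) + k, by have := a.isLt; omega⟩ : Fin (2 * k))))) :
    Real.logb 2 k - ((k : ℝ) - 1) * ε / 2 * Real.logb 2 ((k : ℝ) - 1)
        - binH (((k : ℝ) - 1) * ε / 2) ≤
      mutualInfo (fun z : Fin (2 * k) × Fin d => (1 / (2 * (k : ℝ))) * P z.1 z.2) := by
  have hkR : (2 : ℝ) ≤ k := by exact_mod_cast hk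
  have hk1 : (0 : ℝ) < (k : ℝ) - 1 := by linarith
  set δ : ℝ := ((k : ℝ) - 1) * ε / 2 with hδ
  have hδ0 : 0 ≤ δ := by positivity
  have hδ1 : δ < 1 / 2 := by
    rw [lt_div_iff₀ hk1] at hε
    rw [hδ]; linarith
  set q : Fin (2 * k) × Fin d → ℝ := fun z => (1 / (2 * (k : ℝ))) * P z.1 z.2 with hq
  have hq0 : ∀ z, 0 ≤ q z := fun z => mul_nonneg (by positivity) (hP0 _ _)
  let lo : Fin k → Fin (2 * k) := fun a => ⟨(a : ℕ), by have := a.isLt; omega⟩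
  let hi : Fin k → Fin (2 * k) := fun a => ⟨(a : ℕ) + k, by have := a.isLt; omega⟩
  have hsplit : ∀ F : Fin (2 * k) → ℝ, ∑ a, F a = ∑ a : Fin k, (F (lo a) + F (hi a)) :=
    Fin.sum_univ_two_mul_eq k
  let w : Fin d → ℕ → ℝ := fun j i =>
    if h : i < k then q (lo ⟨i, h⟩, j) + q (hi ⟨i, h⟩, j) else 0
  have hw0 : ∀ j i, 0 ≤ w j i := by
    intro j i
    simp only [w]
    split_ifs
    · exact add_nonneg (hq0 _) (hq0 _)
    · exact le_rfl
  have hwfin : ∀ j (a : Fin k), w j a = q (lo a, j) + q (hi a, j) := fun j a => by simp [w]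
  have hwW : ∀ j, ∑ a, q (a, j) = ∑ i ∈ Finset.range k, w j i := by
    intro j
    rw [hsplit, Finset.sum_range]
    exact Finset.sum_congr rfl fun a _ => (hwfin j a).symm
  have hmargA : ∀ a, ∑ j, q (a, j) = 1 / (2 * (k : ℝ)) := by
    intro a
    simp only [hq]
    rw [← Finset.mul_sum, hP1, mul_one]
  have htotal : ∑ j, ∑ i ∈ Finset.range k, w j i = 1 := by
    simp only [← hwW]
    rw [Finset.sum_comm]
    simp only [hmargA, Finset.sum_const, Finset.card_univ, Fintype.card_fin, nsmul_eq_mul]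
    push_cast
    field_simp
  have hcut : ∀ r ∈ Finset.Icc 1 (k - 1), ∑ j, (∑ i ∈ Finset.range k, w j i -
      |2 * ∑ i ∈ Finset.range r, w j i - ∑ i ∈ Finset.range k, w j i|) / 2 ≤ ε / 2 := by
    intro r hr
    rw [Finset.mem_Icc] at hr
    have h := hsep r hr.1 hr.2
    rw [l1norm, Finset.mul_sum] at h
    rw [← Finset.sum_div, Finset.sum_sub_distrib, htotal]
    suffices 1 - ε ≤ ∑ j, |2 * ∑ i ∈ Finset.range r, w j i - ∑ i ∈ Finset.range k, w j i| by
      linarith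
    refine h.trans_eq (Finset.sum_congr rfl fun j _ => ?_)
    rw [← sum_range_sign_mul k r (by omega), Finset.sum_range,
      ← abs_of_nonneg (show (0 : ℝ) ≤ 1 / (2 * (k : ℝ)) by positivity), ← abs_mul,
      Finset.sum_apply,
      Finset.mul_sum]
    congr 1
    refine Finset.sum_congr rfl fun a _ => ?_
    rw [hwfin]
    simp only [hq, Pi.smul_apply, Pi.add_apply, smul_eq_mul, lo, hi]
    ring
  choose m hmk hm using fun j => exists_sub_le_sum_cuts k (by omega) (w j) (hw0 j)
  set p : ℝ := ∑ j, (∑ i ∈ Finset.range k, w j i - w j (m j)) with hp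
  have hpj : ∀ j, 0 ≤ ∑ i ∈ Finset.range k, w j i - w j (m j) := fun j =>
    sub_nonneg.2 (Finset.single_le_sum (fun i _ => hw0 j i) (Finset.mem_range.2 (hmk j)))
  have hp0 : 0 ≤ p := Finset.sum_nonneg fun j _ => hpj j
  have hpδ : p ≤ δ := by
    calc p ≤ _ := Finset.sum_le_sum fun j _ => hm j
      _ ≤ ∑ _r ∈ Finset.Icc 1 (k - 1), ε / 2 := by
        rw [Finset.sum_comm]
        exact Finset.sum_le_sum hcut
      _ = δ := by
        rw [Finset.sum_const, Nat.card_Icc, nsmul_eq_mul, Nat.add_sub_cancel,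
          Nat.cast_sub (by omega), hδ]
        push_cast
        ring
  let v : Fin (2 * k) × Fin d → ℝ := fun z =>
    if (z.1 : ℕ) % k = m z.2 then (1 - δ) / 2 else δ / (2 * ((k : ℝ) - 1))
  have hmodlo : ∀ a : Fin k, (lo a : ℕ) % k = a := fun a => Nat.mod_eq_of_lt a.isLt
  have hmodhi : ∀ a : Fin k, (hi a : ℕ) % k = a := fun a => by
    simp [hi, Nat.mod_eq_of_lt a.isLt]
  have hv0 : ∀ z, 0 ≤ v z := by
    intro z
    simp only [v]
    split_ifs
    · linarith
    · positivity
  have hv1 : ∀ j, ∑ a, v (a, j) = 1 := by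
    intro j
    rw [hsplit]
    simp only [v, hmodlo, hmodhi]
    rw [Finset.sum_add_distrib, Fin.sum_ite_val_eq (hmk j)]
    field_simp
    ring
  have hqv : ∀ z, v z = 0 → q z = 0 := by
    rintro ⟨a, j⟩ h
    simp only [v] at h
    split_ifs at h with ha
    · linarith
    · have hδz : δ = 0 := by
        rcases div_eq_zero_iff.1 h with h | h
        · exact h
        · linarith
      have hpz : p = 0 := le_antisymm (hpδ.trans_eq hδz) hp0
      have hj := (Finset.sum_eq_zero_iff_of_nonneg fun j _ => hpj j).1 hpz j (Finset.mem_univ j)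
      have hak : (a : ℕ) % k < k := Nat.mod_lt _ (by omega)
      have hle : w j (m j) + w j ((a : ℕ) % k) ≤ ∑ i ∈ Finset.range k, w j i := by
        rw [← Finset.sum_pair (f := w j) (Ne.symm ha)]
        refine Finset.sum_le_sum_of_subset_of_nonneg (fun i hi => ?_) fun i _ _ => hw0 j i
        simp only [Finset.mem_insert, Finset.mem_singleton, Finset.mem_range] at *
        rcases hi with rfl | rfl
        · exact hmk j
        · exact hak
      have hqw : q (a, j) ≤ w j ((a : ℕ) % k) := by
        rw [hwfin j ⟨_, hak⟩]
        rcases lt_or_ge (a : ℕ) k with hlt | hge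
        · have : lo ⟨(a : ℕ) % k, hak⟩ = a := Fin.ext (Nat.mod_eq_of_lt hlt)
          rw [this]
          linarith [hq0 (hi ⟨(a : ℕ) % k, hak⟩, j)]
        · have : hi ⟨(a : ℕ) % k, hak⟩ = a := by
            refine Fin.ext ?_
            have h1 : (a : ℕ) % k = a - k := by
              rw [Nat.mod_eq_sub_mod hge, Nat.mod_eq_of_lt (by have := a.isLt; omega)]
            simp only [hi, h1]
            omega
          rw [this]
          linarith [hq0 (lo ⟨(a : ℕ) % k, hak⟩, j)]
      linarith [hq0 (a, j)]
  have hmain := sum_mul_logb_le_entropy_sub q v hq0 hv0 hv1 hqv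
  set α := Real.logb 2 ((1 - δ) / 2) with hα
  set β := Real.logb 2 (δ / (2 * ((k : ℝ) - 1))) with hβ
  have hcross : ∑ z, q z * Real.logb 2 (v z) = α - p * (α - β) := by
    have hj : ∀ j, ∑ a, q (a, j) * Real.logb 2 (v (a, j)) =
        (∑ i ∈ Finset.range k, w j i) * α -
          (∑ i ∈ Finset.range k, w j i - w j (m j)) * (α - β) := by
      intro j
      have hterm : ∀ a : Fin k, q (lo a, j) * Real.logb 2 (v (lo a, j)) +
          q (hi a, j) * Real.logb 2 (v (hi a, j)) =
          w j a * β + if (a : ℕ) = m j then w j a * (α - β) else 0 := by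
        intro a
        simp only [v, hmodlo, hmodhi, hwfin]
        split_ifs <;> ring
      rw [hsplit, Finset.sum_congr rfl fun a _ => hterm a, ← Finset.sum_range fun i =>
        w j i * β + if i = m j then w j i * (α - β) else 0, Finset.sum_add_distrib,
        ← Finset.sum_mul, Finset.sum_ite_eq', if_pos (Finset.mem_range.2 (hmk j))]
      ring
    rw [Fintype.sum_prod_type_right, Finset.sum_congr rfl fun j _ => hj j,
      Finset.sum_sub_distrib, ← Finset.sum_mul, ← Finset.sum_mul, htotal, one_mul]
  have hHA : shannonEntropy (fun a => ∑ j, q (a, j)) = 1 + Real.logb 2 k := by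
    simp only [shannonEntropy, hmargA, Finset.sum_const, Finset.card_univ, Fintype.card_fin,
      nsmul_eq_mul]
    rw [one_div, Real.logb_inv, Real.logb_mul (by norm_num) (by positivity),
      Real.logb_self_eq_one one_lt_two]
    push_cast
    field_simp
  have hα' : α = Real.logb 2 (1 - δ) - 1 := by
    rw [hα, Real.logb_div (by linarith) (by norm_num), Real.logb_self_eq_one one_lt_two]
  rw [mutualInfo, hHA]
  rw [hcross] at hmain
  unfold binH
  rcases hδ0.eq_or_lt with hz | hpos
  · have hpz : p = 0 := le_antisymm (hpδ.trans_eq hz.symm) hp0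
    rw [hpz] at hmain
    rw [← hz] at hα' ⊢
    simp only [sub_zero, Real.logb_one, zero_mul, mul_zero, neg_zero] at *
    linarith
  · have hβ' : β = Real.logb 2 δ - 1 - Real.logb 2 ((k : ℝ) - 1) := by
      rw [hβ, Real.logb_div hpos.ne' (by positivity), Real.logb_mul (by norm_num) hk1.ne',
        Real.logb_self_eq_one one_lt_two]
      ring
    have hβα : β ≤ α := by
      refine Real.logb_le_logb_of_le one_lt_two (by positivity) ?_
      rw [div_le_div_iff₀ (by positivity) (by norm_num)]
      nlinarith
    have hmul := mul_le_mul_of_nonneg_right hpδ (sub_nonneg.2 hβα)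
    have hfinal : α - δ * (α - β) = (1 - δ) * Real.logb 2 (1 - δ) + δ * Real.logb 2 δ
        - δ * Real.logb 2 ((k : ℝ) - 1) - 1 := by
      rw [hα', hβ']; ring
    linarith
end

section
/- For any integer k ≥ 1 and any nonnegative real numbers p₁, …, p_k, one has (Σ_{i=1}^{k} p_i) − max{p₁,…,p_k} ≤ (1/2)·Σ_{r=1}^{k−1} ( (Σ_{i=1}^{k} p_i) − | Σ_{i=1}^{r} p_i − Σ_{i=r+1}^{k} p_i | ). -/
open Finset in
/-- A sequence of nonnegative reals has an index at which its partial sums cross half of the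
total. -/
theorem exists_partial_sum_crosses_half {k : ℕ} (hk : 1 ≤ k) {p : Fin k → ℝ} (hp : ∀ i, 0 ≤ p i) :
    ∃ m : Fin k, 2 * (∑ i : Fin k, if (i : ℕ) < m then p i else 0) ≤ ∑ i, p i ∧
      ∑ i, p i ≤ 2 * ∑ i : Fin k, if (i : ℕ) < m + 1 then p i else 0 := by
  classical
  have hS : 0 ≤ ∑ i, p i := sum_nonneg fun i _ => hp i
  have hex : ∃ m : ℕ, ∑ i, p i ≤ 2 * ∑ i : Fin k, if (i : ℕ) < m + 1 then p i else 0 := by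
    refine ⟨k, ?_⟩
    have : (∑ i : Fin k, if (i : ℕ) < k + 1 then p i else 0) = ∑ i, p i :=
      sum_congr rfl fun i _ => if_pos (by omega)
    linarith
  have hlt : Nat.find hex < k := by
    refine lt_of_le_of_lt (Nat.find_min' hex (m := k - 1) ?_) (by omega)
    have : (∑ i : Fin k, if (i : ℕ) < k - 1 + 1 then p i else 0) = ∑ i, p i :=
      sum_congr rfl fun i _ => if_pos (by omega)
    linarith
  have hspec := Nat.find_spec hex
  have hmin (n : ℕ) (hn : n < Nat.find hex) := Nat.find_min hex hn
  generalize Nat.find hex = m at hlt hspec hmin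
  refine ⟨⟨m, hlt⟩, ?_, hspec⟩
  cases m with
  | zero => simpa using hS
  | succ n => exact (not_le.mp (hmin n n.lt_succ_self)).le

/-- For any `k ≥ 1` and nonnegative reals `p₁, …, p_k`,
`(Σ_i p_i) − max_i p_i ≤ (1/2)·Σ_{r=1}^{k−1} ((Σ_i p_i) − |Σ_{i≤r} p_i − Σ_{i>r} p_i|)`.
Here `Σ_{i≤r} p_i − Σ_{i>r} p_i` is written as the signed sum
`Σ_{i : Fin k} (if i < r then p i else −p i)`. -/
theorem max_signed_sums_inequality (k : ℕ) (hk : 1 ≤ k)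
    (p : Fin k → ℝ) (hp : ∀ i, 0 ≤ p i) :
    (∑ i, p i) - Finset.univ.sup' ⟨⟨0, by omega⟩, Finset.mem_univ _⟩ p ≤
      (1 / 2) * ∑ r ∈ Finset.Icc 1 (k - 1),
        ((∑ i, p i) - |∑ i : Fin k, (if (i : ℕ) < r then p i else -p i)|) := by
  obtain ⟨m, hm₁, hm₂⟩ := exists_partial_sum_crosses_half hk hp
  set S := ∑ i, p i with hS
  set A : ℕ → ℝ := fun r => ∑ i : Fin k, if (i : ℕ) < r then p i else 0 with hA
  change 2 * A m ≤ S at hm₁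
  change S ≤ 2 * A (m + 1) at hm₂
  have signed_sum (r : ℕ) : (∑ i : Fin k, if (i : ℕ) < r then p i else -p i) = 2 * A r - S := by
    rw [hA, hS, Finset.mul_sum, ← Finset.sum_sub_distrib]
    refine Finset.sum_congr rfl fun i _ => ?_
    split_ifs <;> ring
  have A_nonneg (r : ℕ) : 0 ≤ A r :=
    Finset.sum_nonneg fun i _ => by split_ifs <;> simp [hp]
  have A_le (r : ℕ) : A r ≤ S :=
    Finset.sum_le_sum fun i _ => by split_ifs <;> simp [hp]
  have A_zero : A 0 = 0 := by simp [hA]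
  have A_last : A k = S := Finset.sum_congr rfl fun i _ => if_pos i.isLt
  have A_succ : A (m + 1) = A m + p m := by
    have : p m = ∑ i, if i = m then p i else 0 := by simp
    rw [this, ← Finset.sum_add_distrib]
    refine Finset.sum_congr rfl fun i _ => ?_
    rcases lt_trichotomy (i : ℕ) m with h | h | h
    · simp [h, h.trans (Nat.lt_succ_self _), Fin.ne_of_lt h]
    · simp [Fin.ext h]
    · simp [h.not_gt, Nat.not_lt.mpr (Nat.succ_le_of_lt h), Fin.ne_of_gt h]
  have term_nonneg (r : ℕ) : 0 ≤ S - |2 * A r - S| :=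
    sub_nonneg.mpr (abs_le.mpr ⟨by linarith [A_nonneg r], by linarith [A_le r]⟩)
  have S_nonneg : 0 ≤ S := (A_nonneg 0).trans (A_le 0)
  have sum_extend : ∑ r ∈ Finset.Icc 1 (k - 1), (S - |2 * A r - S|) =
      ∑ r ∈ Finset.range (k + 1), (S - |2 * A r - S|) := by
    refine Finset.sum_subset (fun r hr => ?_) fun r hr hr' => ?_
    · simp only [Finset.mem_Icc, Finset.mem_range] at *
      omega
    · simp only [Finset.mem_Icc, Finset.mem_range] at *
      obtain rfl | rfl : r = 0 ∨ r = k := by omega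
      · simp [A_zero, abs_of_nonneg S_nonneg]
      · rw [A_last, abs_of_nonneg (by linarith)]
        ring
  have two_terms : ∑ r ∈ {(m : ℕ), (m : ℕ) + 1}, (S - |2 * A r - S|) ≤
      ∑ r ∈ Finset.range (k + 1), (S - |2 * A r - S|) := by
    refine Finset.sum_le_sum_of_subset_of_nonneg (fun r hr => ?_) fun r _ _ => term_nonneg r
    simp only [Finset.mem_insert, Finset.mem_singleton, Finset.mem_range] at *
    omega
  rw [Finset.sum_pair (Nat.lt_succ_self _).ne, abs_of_nonpos (sub_nonpos.mpr hm₁),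
    abs_of_nonneg (sub_nonneg.mpr hm₂)] at two_terms
  have p_le_max := Finset.le_sup' p (Finset.mem_univ m)
  simp only [signed_sum, sum_extend]
  linarith
end

section
/- Let k ≥ 2 and d ≥ 1 be integers and let ε ≥ 0. Let Q₁, …, Q_k ∈ ℝ^d be nonnegative vectors, each with coordinates summing to 1. Assume that for all r ∈ [k−1], (1/k)·‖ Σ_{a=1}^{r} Q_a − Σ_{a=r+1}^{k} Q_a ‖₁ ≥ 1 − ε. Then (1/k)·Σ_{j=1}^{d} max{Q₁(j), …, Q_k(j)} ≥ 1 − (k−1)ε/2. -/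
/-- If `F` starts at `0`, is nondecreasing, bounded by `S` and has increments at most `M`, then the
sum of `|2 F - S|` is controlled by the single increment at which `2 F` crosses `S`. -/
theorem sum_abs_two_mul_sub_le (F : ℕ → ℝ) (S M : ℝ) (h0 : F 0 = 0) (hmono : Monotone F)
    (hS : ∀ n, F n ≤ S) (hM : ∀ n, F (n + 1) ≤ F n + M) (m : ℕ) :
    (2 * F m ≤ S → ∑ r ∈ Finset.range m, |2 * F (r + 1) - S| ≤ m * S - 2 * F m) ∧
    (S < 2 * F m → ∑ r ∈ Finset.range m, |2 * F (r + 1) - S| ≤ (m - 2) * S + 2 * M) := by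
  induction m with
  | zero =>
    have := hS 0
    simp only [Finset.range_zero, Finset.sum_empty, h0] at *
    refine ⟨fun _ => by norm_num, fun h => by linarith⟩
  | succ m ih =>
    have hle := hmono (Nat.le_add_right m 1)
    have hnonneg := hmono (Nat.zero_le m)
    have hSm := hS (m + 1)
    have hMm := hM m
    rw [Finset.sum_range_succ]
    push_cast
    refine ⟨fun h => ?_, fun h => ?_⟩
    · have := ih.1 (by linarith)
      rw [abs_of_nonpos (by linarith)]
      linarith
    · rw [abs_of_pos (by linarith)]
      rcases le_or_gt (2 * F m) S with h' | h'
      · have := ih.1 h'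
        linarith
      · have := ih.2 h'
        linarith

/-- For nonnegative reals `x` bounded by `M`, the sum over all proper cuts of the absolute
difference between the two parts is at most `(k - 3) ∑ x + 2 M`. -/
theorem sum_abs_signed_sum_le {k : ℕ} (hk : 1 ≤ k) (x : Fin k → ℝ) (hx : ∀ a, 0 ≤ x a) (M : ℝ)
    (hM : ∀ a, x a ≤ M) :
    ∑ r ∈ Finset.range (k - 1), |∑ a : Fin k, (if (a : ℕ) < r + 1 then (1 : ℝ) else -1) * x a| ≤
      ((k : ℝ) - 3) * ∑ a, x a + 2 * M := by
  set S := ∑ a, x a with hS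
  set F : ℕ → ℝ := fun r => ∑ a : Fin k, if (a : ℕ) < r then x a else 0 with hF
  have hsign (r : ℕ) :
      ∑ a : Fin k, (if (a : ℕ) < r then (1 : ℝ) else -1) * x a = 2 * F r - S := by
    simp only [hF, hS, Finset.mul_sum, ← Finset.sum_sub_distrib]
    refine Finset.sum_congr rfl fun a _ => ?_
    split_ifs <;> ring
  have hM0 : 0 ≤ M := (hx ⟨0, hk⟩).trans (hM ⟨0, hk⟩)
  have h0 : F 0 = 0 := by simp [hF]
  have hmono : Monotone F := by
    intro r s hrs
    refine Finset.sum_le_sum fun a _ => ?_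
    have := hx a
    split_ifs <;> first | omega | linarith
  have hFS (n : ℕ) : F n ≤ S := by
    refine Finset.sum_le_sum fun a _ => ?_
    have := hx a
    split_ifs <;> linarith
  have hstep (n : ℕ) : F (n + 1) ≤ F n + M := by
    have hdiff : F (n + 1) - F n = ∑ a : Fin k, if (a : ℕ) = n then x a else 0 := by
      simp only [hF, ← Finset.sum_sub_distrib]
      refine Finset.sum_congr rfl fun a _ => ?_
      split_ifs <;> first | omega | simp
    have hle : ∑ a : Fin k, (if (a : ℕ) = n then x a else 0) ≤ M := by
      by_cases hn : n < k
      · rw [Finset.sum_eq_single ⟨n, hn⟩]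
        · simpa using hM ⟨n, hn⟩
        · intro b _ hb
          exact if_neg fun h => hb (Fin.ext h)
        · simp
      · rw [Finset.sum_eq_zero]
        · exact hM0
        · intro a _
          exact if_neg (by omega)
    linarith
  have hFk : F (k - 1 + 1) = S := by
    refine Finset.sum_congr rfl fun a _ => if_pos (by omega)
  have key := sum_abs_two_mul_sub_le F S M h0 hmono hFS hstep (k - 1)
  have hlast := hstep (k - 1)
  simp only [hsign]
  rw [Nat.cast_sub hk] at key
  push_cast at key
  rcases le_or_gt (2 * F (k - 1)) S with h | h
  · have := key.1 h
    linarith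
  · have := key.2 h
    linarith

/-- Let `Q₁, …, Q_k` be probability distributions on `[d]` (nonnegative vectors with
coordinates summing to 1) such that for all `r ∈ [k−1]`,
`(1/k)·‖ Σ_{a=1}^r Q_a − Σ_{a=r+1}^k Q_a ‖₁ ≥ 1−ε` (written via the signed sum
`Σ_{a : Fin k} (if a < r then 1 else −1) • Q_a`). Then
`(1/k)·Σ_j max_a Q_a(j) ≥ 1 − (k−1)ε/2`. -/
theorem pointwise_max_lower_bound (k d : ℕ) (hk : 2 ≤ k) (hd : 1 ≤ d)
    (ε : ℝ) (hε : 0 ≤ ε)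
    (Q : Fin k → Fin d → ℝ)
    (hQ0 : ∀ a j, 0 ≤ Q a j) (hQ1 : ∀ a, ∑ j, Q a j = 1)
    (hsep : ∀ r : ℕ, 1 ≤ r → r ≤ k - 1 →
      1 - ε ≤ (1 / (k : ℝ)) * l1norm
        (∑ a : Fin k, (if (a : ℕ) < r then (1 : ℝ) else -1) • Q a)) :
    1 - ((k : ℝ) - 1) * ε / 2 ≤
      (1 / (k : ℝ)) * ∑ j : Fin d,
        Finset.univ.sup' ⟨⟨0, by omega⟩, Finset.mem_univ _⟩ (fun a => Q a j) := by
  have hk0 : (0 : ℝ) < k := by exact_mod_cast (by omega : 0 < k)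
  set M : Fin d → ℝ := fun j =>
    Finset.univ.sup' ⟨⟨0, by omega⟩, Finset.mem_univ _⟩ (fun a => Q a j) with hM
  have hpoint (j : Fin d) := sum_abs_signed_sum_le (by omega : 1 ≤ k) (fun a => Q a j)
    (fun a => hQ0 a j) (M j) (fun a => Finset.le_sup' (fun a => Q a j) (Finset.mem_univ a))
  have hsum := Finset.sum_le_sum fun j (_ : j ∈ Finset.univ) => hpoint j
  rw [Finset.sum_comm, Finset.sum_add_distrib, ← Finset.mul_sum, ← Finset.mul_sum,
    Finset.sum_comm (f := fun j a => Q a j)] at hsum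
  simp only [hQ1, Finset.sum_const, Finset.card_univ, Fintype.card_fin, nsmul_eq_mul,
    mul_one] at hsum
  have hlow : ((k : ℝ) - 1) * (k * (1 - ε)) ≤ ∑ r ∈ Finset.range (k - 1), ∑ j : Fin d,
      |∑ a : Fin k, (if (a : ℕ) < r + 1 then (1 : ℝ) else -1) * Q a j| := by
    have hterm : ∀ r ∈ Finset.range (k - 1), (k : ℝ) * (1 - ε) ≤ ∑ j : Fin d,
        |∑ a : Fin k, (if (a : ℕ) < r + 1 then (1 : ℝ) else -1) * Q a j| := by
      intro r hr
      have hr' := Finset.mem_range.mp hr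
      have h := hsep (r + 1) (by omega) (by omega)
      rw [one_div, inv_mul_eq_div, le_div_iff₀ hk0] at h
      simp only [l1norm, Finset.sum_apply, Pi.smul_apply, smul_eq_mul] at h
      linarith
    have h := Finset.card_nsmul_le_sum _ _ _ hterm
    rw [Finset.card_range, nsmul_eq_mul, Nat.cast_sub (by omega : 1 ≤ k), Nat.cast_one] at h
    exact h
  rw [one_div, inv_mul_eq_div, le_div_iff₀ hk0]
  linarith
end

section
/- Let k ≥ 2 and n ≥ 1 be integers, let d ≥ 1, and let ε be a real number with 0 ≤ ε < 1/(k−1). Suppose f : ([2k])^n → ℝ^d satisfies, for all x₁,…,xₙ ∈ [2k], that f(x₁,…,xₙ) has nonnegative coordinates and ‖f(x₁,…,xₙ)‖₁ = 1, and moreover that for every ℓ ∈ [n], every x₁,…,x_{ℓ−1} ∈ [2k], and every r ∈ [k−1], one has (1/(2k))·‖ Σ_{b=1}^{r} (f̄(x₁,…,x_{ℓ−1},b) + f̄(x₁,…,x_{ℓ−1},b+k)) − Σ_{b=r+1}^{k} (f̄(x₁,…,x_{ℓ−1},b) + f̄(x₁,…,x_{ℓ−1},b+k)) ‖₁ ≥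 1 − ε, where f̄(x₁,…,x_ℓ) denotes the average of f(x₁,…,xₙ) over x_{ℓ+1},…,xₙ chosen uniformly and independently from [2k]. Then, setting δ := (k−1)ε/2, we have d ≥ 2^{(log₂ k − δ·log₂(k−1) − H(δ))·n}. -/
/-- A termwise form of Gibbs' inequality. -/
lemma gibbs_term {a S R : ℝ} (ha : 0 ≤ a) (hS : 0 ≤ S) (hR : 0 ≤ R)
    (h : a = 0 ∨ (0 < S ∧ 0 < R)) :
    a * Real.log S + a * Real.log R + a - S * R ≤ a * Real.log a := by
  rcases ha.eq_or_lt with rfl | ha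
  · have := mul_nonneg hS hR
    simp only [zero_mul]
    linarith
  · obtain ⟨hS, hR⟩ := h.resolve_left ha.ne'
    have hx : 0 < S * R / a := by positivity
    have h1 := Real.log_le_sub_one_of_pos hx
    rw [Real.log_div (by positivity) ha.ne', Real.log_mul hS.ne' hR.ne'] at h1
    have h2 := mul_le_mul_of_nonneg_left h1 ha.le
    have h3 : a * (S * R / a - 1) = S * R - a := by field_simp
    rw [h3] at h2
    linarith

/-- The entropy of a distribution on `d` points is at most `log d`. -/
lemma sum_negMulLog_le_log_card {d : ℕ} (hd : 1 ≤ d) (p : Fin d → ℝ) (hp : ∀ j, 0 ≤ p j)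
    (hsum : ∑ j, p j = 1) : ∑ j, Real.negMulLog (p j) ≤ Real.log d := by
  have hd' : (0 : ℝ) < d := by exact_mod_cast hd
  have h : ∀ j, Real.negMulLog (p j) ≤ p j * Real.log d - p j + 1 / d := by
    intro j
    have := gibbs_term (hp j) zero_le_one (R := 1 / (d : ℝ)) (by positivity)
      (Or.inr ⟨one_pos, by positivity⟩)
    rw [one_div, Real.log_inv, Real.log_one] at this
    rw [Real.negMulLog, one_div]
    linarith
  calc ∑ j, Real.negMulLog (p j) ≤ ∑ j, (p j * Real.log d - p j + 1 / d) :=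
        Finset.sum_le_sum fun j _ => h j
    _ = Real.log d := by
        rw [Finset.sum_add_distrib, Finset.sum_sub_distrib, ← Finset.sum_mul, hsum]
        simp [hd'.ne']

lemma sum_range_skip (a : ℕ → ℝ) (m t : ℕ) (ht : t < m + 1) :
    ∑ r ∈ Finset.range m, (if r < t then a r else a (r + 1)) + a t
      = ∑ b ∈ Finset.range (m + 1), a b := by
  induction m with
  | zero =>
    obtain rfl : t = 0 := by omega
    simp
  | succ m ih =>
    rcases Nat.lt_succ_iff_lt_or_eq.mp ht with h | rfl
    · rw [Finset.sum_range_succ, Finset.sum_range_succ _ (m + 1), ← ih h,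
        if_neg (by omega)]
      ring
    · rw [Finset.sum_range_succ _ (m + 1)]
      congr 1
      refine Finset.sum_congr rfl fun r hr => ?_
      rw [if_pos (Finset.mem_range.mp hr)]

/-- All mass away from a median is controlled by the cut imbalances. -/
lemma exists_median (a : ℕ → ℝ) (ha : ∀ b, 0 ≤ a b) (m : ℕ) :
    ∃ t < m + 1, 2 * (∑ b ∈ Finset.range (m + 1), a b - a t) ≤
      ∑ r ∈ Finset.range m, (∑ b ∈ Finset.range (m + 1), a b -
        |2 * ∑ b ∈ Finset.range (r + 1), a b - ∑ b ∈ Finset.range (m + 1), a b|) := by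
  set S := ∑ b ∈ Finset.range (m + 1), a b with hS
  have hmono : Monotone fun r => ∑ b ∈ Finset.range r, a b := fun r s hrs =>
    Finset.sum_le_sum_of_subset_of_nonneg (Finset.range_mono hrs) fun b _ _ => ha b
  have hS0 : 0 ≤ S := Finset.sum_nonneg fun b _ => ha b
  have hex : ∃ t, S / 2 ≤ ∑ b ∈ Finset.range (t + 1), a b := ⟨m, by rw [← hS]; linarith⟩
  classical
  have hfind := Nat.find_spec hex
  have hmin : ∀ r < Nat.find hex, ∑ b ∈ Finset.range (r + 1), a b < S / 2 := fun r hr =>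
    not_le.mp (Nat.find_min hex hr)
  have htm : Nat.find hex ≤ m := Nat.find_min' hex (by rw [← hS]; linarith)
  generalize Nat.find hex = t at *
  refine ⟨t, by omega, ?_⟩
  have hskip := sum_range_skip a m t (by omega)
  rw [← hS] at hskip
  have : S - a t = ∑ r ∈ Finset.range m, (if r < t then a r else a (r + 1)) := by linarith
  rw [this, Finset.mul_sum]
  refine Finset.sum_le_sum fun r hr => ?_
  have hr' := Finset.mem_range.mp hr
  split_ifs with h
  · have h1 := hmin r h
    rw [abs_of_nonpos (by linarith)]
    have : a r ≤ ∑ b ∈ Finset.range (r + 1), a b :=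
      Finset.single_le_sum (fun b _ => ha b) (Finset.self_mem_range_succ r)
    linarith
  · have h1 : S / 2 ≤ ∑ b ∈ Finset.range (r + 1), a b :=
      hfind.trans (hmono (by omega))
    rw [abs_of_nonneg (by linarith)]
    have h2 : ∑ b ∈ Finset.range (r + 1 + 1), a b ≤ S := hmono (by omega)
    rw [Finset.sum_range_succ] at h2
    linarith

lemma exists_median_fin {k : ℕ} (hk : 1 ≤ k) (a : Fin k → ℝ) (ha : ∀ b, 0 ≤ a b) :
    ∃ t : Fin k, 2 * (∑ b, a b - a t) ≤
      ∑ r ∈ Finset.range (k - 1), (∑ b, a b -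
        |∑ b : Fin k, (if (b : ℕ) < r + 1 then (1 : ℝ) else -1) * a b|) := by
  obtain ⟨m, rfl⟩ : ∃ m, k = m + 1 := ⟨k - 1, by omega⟩
  let a' : ℕ → ℝ := fun b => if h : b < m + 1 then a ⟨b, h⟩ else 0
  have ha'eq : ∀ b : Fin (m + 1), a b = a' b := fun b => by
    simp only [a', dif_pos b.isLt, Fin.eta]
  have ha' : ∀ b, 0 ≤ a' b := fun b => by
    simp only [a']
    split_ifs
    · exact ha _
    · exact le_rfl
  obtain ⟨t, ht, hle⟩ := exists_median a' ha' m
  refine ⟨⟨t, ht⟩, ?_⟩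
  simp only [ha'eq, add_tsub_cancel_right]
  rw [Fin.sum_univ_eq_sum_range a']
  refine hle.trans_eq (Finset.sum_congr rfl fun r hr => ?_)
  have hr' := Finset.mem_range.mp hr
  rw [Fin.sum_univ_eq_sum_range fun b => (if b < r + 1 then (1 : ℝ) else -1) * a' b]
  have h1 : ∀ b, (if b < r + 1 then (1 : ℝ) else -1) * a' b
      = 2 * (if b < r + 1 then a' b else 0) - a' b := fun b => by
    split_ifs <;> ring
  simp only [h1]
  rw [Finset.sum_sub_distrib, ← Finset.mul_sum, ← Finset.sum_filter]
  have h2 : (Finset.range (m + 1)).filter (· < r + 1) = Finset.range (r + 1) := by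
    ext b
    simp only [Finset.mem_filter, Finset.mem_range]
    omega
  rw [h2]

/-- The per-coordinate gain in nats: `log k` minus the Fano bound at error probability `δ`. -/
noncomputable def fanoGain (k : ℕ) (δ : ℝ) : ℝ :=
  Real.log k - δ * Real.log ((k : ℝ) - 1) + δ * Real.log δ + (1 - δ) * Real.log (1 - δ)

lemma sum_mul_log_ge {k : ℕ} (hk : 2 ≤ k) (a : Fin k → ℝ) (ha : ∀ b, 0 ≤ a b) (t : Fin k)
    {δ : ℝ} (hδ0 : 0 ≤ δ) (hδ1 : δ < 1) (hz : δ = 0 → ∑ b, a b - a t = 0) :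
    (∑ b, a b) * Real.log (∑ b, a b) + a t * Real.log (1 - δ) +
      (∑ b, a b - a t) * Real.log (δ / ((k : ℝ) - 1)) ≤ ∑ b, a b * Real.log (a b) := by
  have hk1 : (0 : ℝ) < (k : ℝ) - 1 := by
    have : (2 : ℝ) ≤ k := by exact_mod_cast hk
    linarith
  set S := ∑ b, a b with hS
  have hS0 : 0 ≤ S := Finset.sum_nonneg fun b _ => ha b
  have hle : ∀ b, a b ≤ S := fun b => Finset.single_le_sum (fun b _ => ha b) (Finset.mem_univ b)
  have hsplit : ∀ g : Fin k → ℝ, ∑ b, g b = g t + ∑ b ∈ Finset.univ.erase t, g b := fun g =>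
    (Finset.add_sum_erase _ g (Finset.mem_univ t)).symm
  have hE : S - a t = ∑ b ∈ Finset.univ.erase t, a b := by rw [hS, hsplit a]; ring
  have ht : a t * Real.log S + a t * Real.log (1 - δ) + a t - S * (1 - δ)
      ≤ a t * Real.log (a t) := by
    refine gibbs_term (ha t) hS0 (by linarith) ?_
    rcases (ha t).eq_or_lt with h | h
    · exact Or.inl h.symm
    · exact Or.inr ⟨h.trans_le (hle t), by linarith⟩
  have ho : ∀ b ∈ Finset.univ.erase t, a b * Real.log S + a b * Real.log (δ / ((k : ℝ) - 1))
      + a b - S * (δ / ((k : ℝ) - 1)) ≤ a b * Real.log (a b) := by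
    intro b hb
    refine gibbs_term (ha b) hS0 (by positivity) ?_
    rcases (ha b).eq_or_lt with h | h
    · exact Or.inl h.symm
    · rcases hδ0.eq_or_lt with h0 | h0
      · have h3 := hz h0.symm
        rw [hE, Finset.sum_eq_zero_iff_of_nonneg fun b _ => ha b] at h3
        exact Or.inl (h3 b hb)
      · exact Or.inr ⟨h.trans_le (hle b), by positivity⟩
  have ho' := Finset.sum_le_sum ho
  rw [Finset.sum_sub_distrib, Finset.sum_add_distrib, Finset.sum_add_distrib, ← Finset.sum_mul,
    ← Finset.sum_mul, ← hE, Finset.sum_const, Finset.card_erase_of_mem (Finset.mem_univ t),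
    Finset.card_univ, Fintype.card_fin, nsmul_eq_mul, Nat.cast_sub (by omega), Nat.cast_one] at ho'
  have h4 : ((k : ℝ) - 1) * (S * (δ / ((k : ℝ) - 1))) = S * δ := by field_simp
  rw [h4] at ho'
  rw [hsplit fun b => a b * Real.log (a b)]
  linarith

/-- Fano's inequality for `k` distributions `p b` on `d` points with guess `t`. -/
lemma fano {k d : ℕ} (hk : 2 ≤ k) (p : Fin k → Fin d → ℝ) (hp : ∀ b j, 0 ≤ p b j)
    (hsum : ∀ b, ∑ j, p b j = 1) {δ : ℝ} (hδ0 : 0 ≤ δ) (hδ1 : δ < 1 / 2)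
    (t : Fin d → Fin k) (ht : ∑ j, (∑ b, p b j - p (t j) j) ≤ k * δ) :
    ∑ b, ∑ j, Real.negMulLog (p b j) + k * fanoGain k δ ≤
      k * ∑ j, Real.negMulLog ((∑ b, p b j) / k) := by
  have hk2 : (2 : ℝ) ≤ k := by exact_mod_cast hk
  have hk1 : (0 : ℝ) < (k : ℝ) - 1 := by linarith
  have hE0 : ∀ j, 0 ≤ ∑ b, p b j - p (t j) j := fun j => by
    have := Finset.single_le_sum (f := fun b => p b j) (fun b _ => hp b j)
      (Finset.mem_univ (t j))
    simpa using this
  have hterm : ∀ j, (∑ b, p b j) * Real.log (∑ b, p b j) + p (t j) j * Real.log (1 - δ) +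
      (∑ b, p b j - p (t j) j) * Real.log (δ / ((k : ℝ) - 1))
      ≤ ∑ b, p b j * Real.log (p b j) := fun j => by
    refine sum_mul_log_ge hk (fun b => p b j) (fun b => hp b j) (t j) hδ0 (by linarith) ?_
    rintro rfl
    rw [mul_zero] at ht
    have h0 := le_antisymm ht (Finset.sum_nonneg fun j _ => hE0 j)
    rw [Finset.sum_eq_zero_iff_of_nonneg fun j _ => hE0 j] at h0
    exact h0 j (Finset.mem_univ j)
  have htot : ∑ j, ∑ b, p b j = k := by
    rw [Finset.sum_comm]
    simp [hsum]
  have hmix : ∀ j, (k : ℝ) * Real.negMulLog ((∑ b, p b j) / k) =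
      (∑ b, p b j) * Real.log k - (∑ b, p b j) * Real.log (∑ b, p b j) := fun j => by
    rcases eq_or_ne (∑ b, p b j) 0 with h | h
    · simp [h]
    · rw [Real.negMulLog, Real.log_div h (by positivity)]
      field_simp
      ring
  set E := ∑ j, (∑ b, p b j - p (t j) j) with hE
  have hEt : ∑ j, p (t j) j = k - E := by
    rw [hE, Finset.sum_sub_distrib, htot]
    ring
  have hs := Finset.sum_le_sum fun j (_ : j ∈ Finset.univ) => hterm j
  rw [Finset.sum_add_distrib, Finset.sum_add_distrib, ← Finset.sum_mul, ← Finset.sum_mul, hEt,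
    ← hE] at hs
  rw [Finset.mul_sum, Finset.sum_congr rfl fun j _ => hmix j, Finset.sum_sub_distrib,
    ← Finset.sum_mul, htot]
  have hcomm : ∑ b, ∑ j, Real.negMulLog (p b j) = -∑ j, ∑ b, p b j * Real.log (p b j) := by
    rw [Finset.sum_comm]
    simp [Real.negMulLog, Finset.sum_neg_distrib]
  rw [hcomm, fanoGain]
  rcases hδ0.eq_or_lt with rfl | hδ
  · have : E = 0 := le_antisymm (by simpa using ht) (Finset.sum_nonneg fun j _ => hE0 j)
    simp [this] at hs ⊢
    linarith
  · have hlog : Real.log (δ / ((k : ℝ) - 1)) ≤ Real.log (1 - δ) := by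
      refine Real.log_le_log (by positivity) ?_
      rw [div_le_iff₀ hk1]
      nlinarith
    have h5 := mul_le_mul_of_nonneg_right ht (sub_nonneg.mpr hlog)
    rw [Real.log_div hδ.ne' hk1.ne'] at *
    linarith

lemma negMulLog_midpoint_ge {x y : ℝ} (hx : 0 ≤ x) (hy : 0 ≤ y) :
    (Real.negMulLog x + Real.negMulLog y) / 2 ≤ Real.negMulLog ((x + y) / 2) := by
  have := Real.concaveOn_negMulLog.2 (Set.mem_Ici.mpr hx) (Set.mem_Ici.mpr hy)
    (show (0 : ℝ) ≤ 1 / 2 by norm_num) (show (0 : ℝ) ≤ 1 / 2 by norm_num) (by norm_num)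
  simp only [smul_eq_mul] at this
  rw [show (x + y) / 2 = 1 / 2 * x + 1 / 2 * y by ring]
  linarith

/-- The entropy increment obtained by averaging over one coordinate. -/
lemma entropy_average_ge {k d : ℕ} (hk : 2 ≤ k) {ε : ℝ} (hε0 : 0 ≤ ε)
    (hε : ε < 1 / ((k : ℝ) - 1)) (u v : Fin k → Fin d → ℝ)
    (hu : ∀ b j, 0 ≤ u b j) (hv : ∀ b j, 0 ≤ v b j)
    (hus : ∀ b, ∑ j, u b j = 1) (hvs : ∀ b, ∑ j, v b j = 1) {M : ℝ}
    (huM : ∀ b, M ≤ ∑ j, Real.negMulLog (u b j)) (hvM : ∀ b, M ≤ ∑ j, Real.negMulLog (v b j))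
    (hcut : ∀ r : ℕ, 1 ≤ r → r ≤ k - 1 →
      1 - ε ≤ (1 / (2 * (k : ℝ))) * l1norm
        (∑ b : Fin k, (if (b : ℕ) < r then (1 : ℝ) else -1) • (u b + v b))) :
    M + fanoGain k (((k : ℝ) - 1) * ε / 2) ≤
      ∑ j, Real.negMulLog ((∑ b, (u b j + v b j)) / (2 * k)) := by
  have hk2 : (2 : ℝ) ≤ k := by exact_mod_cast hk
  have hk0 : (0 : ℝ) < k := by linarith
  have hk1 : (0 : ℝ) < (k : ℝ) - 1 := by linarith
  have hδ1 : ((k : ℝ) - 1) * ε / 2 < 1 / 2 := by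
    rw [lt_div_iff₀ hk1] at hε
    linarith
  let p : Fin k → Fin d → ℝ := fun b j => (u b j + v b j) / 2
  have hp : ∀ b j, 0 ≤ p b j := fun b j => by
    have := hu b j
    have := hv b j
    positivity
  have hps : ∀ b, ∑ j, p b j = 1 := fun b => by
    simp only [p]
    rw [← Finset.sum_div, Finset.sum_add_distrib, hus, hvs]
    norm_num
  choose t ht using fun j => exists_median_fin (by omega) (fun b => p b j) fun b => hp b j
  have htot : ∑ j, ∑ b, p b j = k := by
    rw [Finset.sum_comm]
    simp [hps]
  have hE : ∑ j, (∑ b, p b j - p (t j) j) ≤ k * (((k : ℝ) - 1) * ε / 2) := by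
    have h1 := Finset.sum_le_sum fun j (_ : j ∈ Finset.univ) => ht j
    rw [← Finset.mul_sum, Finset.sum_comm] at h1
    have h2 : ∀ r ∈ Finset.range (k - 1), ∑ j, (∑ b, p b j -
        |∑ b : Fin k, (if (b : ℕ) < r + 1 then (1 : ℝ) else -1) * p b j|) ≤ k * ε := by
      intro r hr
      have hr' := Finset.mem_range.mp hr
      have h3 := hcut (r + 1) (by omega) (by omega)
      have h4 : l1norm (∑ b : Fin k, (if (b : ℕ) < r + 1 then (1 : ℝ) else -1) • (u b + v b))
          = 2 * ∑ j, |∑ b : Fin k, (if (b : ℕ) < r + 1 then (1 : ℝ) else -1) * p b j| := by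
        rw [l1norm, Finset.mul_sum]
        refine Finset.sum_congr rfl fun j _ => ?_
        have h2abs : ∀ s : ℝ, 2 * |s| = |2 * s| := fun s => by rw [abs_mul, abs_two]
        rw [h2abs, Finset.mul_sum, Finset.sum_apply]
        congr 1
        refine Finset.sum_congr rfl fun b _ => ?_
        simp only [Pi.smul_apply, Pi.add_apply, smul_eq_mul, p]
        ring
      rw [Finset.sum_sub_distrib, htot]
      rw [h4, one_div_mul_eq_div, le_div_iff₀ (by positivity)] at h3
      linarith
    have h5 := h1.trans (Finset.sum_le_sum h2)
    rw [Finset.sum_const, Finset.card_range, nsmul_eq_mul, Nat.cast_sub (by omega),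
      Nat.cast_one] at h5
    linarith
  have hfano := fano hk p hp hps (by positivity) hδ1 t hE
  have hM : ∀ b, M ≤ ∑ j, Real.negMulLog (p b j) := fun b => by
    have h6 := Finset.sum_le_sum fun j (_ : j ∈ Finset.univ) =>
      negMulLog_midpoint_ge (hu b j) (hv b j)
    rw [← Finset.sum_div, Finset.sum_add_distrib] at h6
    have := huM b
    have := hvM b
    simp only [p]
    linarith
  have hkM : k * M ≤ ∑ b, ∑ j, Real.negMulLog (p b j) := by
    have := Finset.sum_le_sum fun b (_ : b ∈ Finset.univ) => hM b
    simpa using this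
  have hEq : ∀ j, (∑ b, (u b j + v b j)) / (2 * k) = (∑ b, p b j) / k := fun j => by
    simp only [p]
    rw [← Finset.sum_div, div_div]
  simp only [hEq]
  refine le_of_mul_le_mul_left ?_ hk0
  linarith

lemma fbar_full {K n d : ℕ} (f : (Fin n → Fin K) → Fin d → ℝ) (x : Fin n → Fin K) :
    fbar f x = f x := by
  classical
  have h : ∀ y : Fin n → Fin K,
      (∀ i : Fin n, ∀ h : (i : ℕ) < n, y i = x ⟨(i : ℕ), h⟩) ↔ y = x := fun y =>
    ⟨fun h => funext fun i => h i i.isLt, fun h i _ => by rw [h]⟩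
  simp only [fbar, h]
  simp

/-- The average over a prefix is the average over its one-letter extensions. -/
lemma fbar_eq_sum_snoc {K n d : ℕ} (f : (Fin n → Fin K) → Fin d → ℝ) {ℓ : ℕ} (hℓ : ℓ < n)
    (x : Fin ℓ → Fin K) :
    fbar f x = (K : ℝ)⁻¹ • ∑ c : Fin K, fbar f (Fin.snoc x c : Fin (ℓ + 1) → Fin K) := by
  classical
  simp only [fbar]
  rw [← Finset.smul_sum, smul_smul, ← mul_inv, ← pow_succ', Finset.sum_comm,
    show n - (ℓ + 1) + 1 = n - ℓ by omega]
  congr 1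
  refine Finset.sum_congr rfl fun y _ => ?_
  have h : ∀ c, (∀ i : Fin n, ∀ h : (i : ℕ) < ℓ + 1,
      y i = (Fin.snoc x c : Fin (ℓ + 1) → Fin K) ⟨(i : ℕ), h⟩) ↔
      (c = y ⟨ℓ, hℓ⟩ ∧ ∀ i : Fin n, ∀ h : (i : ℕ) < ℓ, y i = x ⟨(i : ℕ), h⟩) := by
    intro c
    constructor
    · intro h
      refine ⟨?_, fun i hi => ?_⟩
      · have := h ⟨ℓ, hℓ⟩ (Nat.lt_succ_self ℓ)
        simpa [Fin.snoc] using this.symm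
      · have := h i (by omega)
        simpa [Fin.snoc, hi] using this
    · rintro ⟨rfl, h⟩ i hi
      by_cases hi' : (i : ℕ) < ℓ
      · simpa [Fin.snoc, hi'] using h i hi'
      · have : i = ⟨ℓ, hℓ⟩ := Fin.ext (by simp; omega)
        subst this
        simp [Fin.snoc]
  simp only [h, ite_and]
  simp

lemma sum_fin_two_mul {k : ℕ} (g : Fin (2 * k) → ℝ) :
    ∑ c, g c = ∑ b : Fin k, (g ⟨(b : ℕ), by have := b.isLt; omega⟩ +
      g ⟨(b : ℕ) + k, by have := b.isLt; omega⟩) := by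
  rw [← Fintype.sum_equiv (finCongr (two_mul k).symm)
    (fun c => g (Fin.cast (two_mul k).symm c)) g (fun _ => rfl), Fin.sum_univ_add,
    ← Finset.sum_add_distrib]
  refine Finset.sum_congr rfl fun b _ => ?_
  congr 2
  exact Fin.ext (by simp [add_comm])

lemma two_rpow_eq_exp_fanoGain (k n : ℕ) (δ : ℝ) :
    (2 : ℝ) ^ ((Real.logb 2 k - δ * Real.logb 2 ((k : ℝ) - 1) - binH δ) * n)
      = Real.exp (n * fanoGain k δ) := by
  have h2 : Real.log 2 ≠ 0 := (Real.log_pos one_lt_two).ne'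
  rw [Real.rpow_def_of_pos two_pos, binH, fanoGain]
  simp only [Real.logb]
  congr 1
  field_simp
  ring

/-- Nonnegative case of the main technical theorem: if `f : [2k]^n → ℝ^d` takes values
that are nonnegative vectors of ℓ1 norm exactly 1 and satisfies, for every `ℓ ∈ [n]`,
every prefix `x₁,…,x_{ℓ−1} ∈ [2k]` and every `r ∈ [k−1]`,
`(1/(2k))·‖ Σ_{b=1}^r (f̄(x…,b) + f̄(x…,b+k)) − Σ_{b=r+1}^k (f̄(x…,b) + f̄(x…,b+k)) ‖₁ ≥ 1−ε`
with `0 ≤ ε < 1/(k−1)`, then `d ≥ 2^{(log₂ k − δ log₂(k−1) − H(δ))n}`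
where `δ = (k−1)ε/2`. Here elements of `[2k] = {1,…,2k}` are represented by `Fin (2k)`
with `b ∈ {1,…,k}` corresponding to the index `b−1` and `b+k` to the index `b−1+k`,
and the prefix of length `ℓ−1` is quantified as a prefix of length `ℓ < n`. -/
theorem main_technical_theorem_nonneg (k n d : ℕ) (hk : 2 ≤ k) (hn : 1 ≤ n) (hd : 1 ≤ d)
    (ε : ℝ) (hε0 : 0 ≤ ε) (hε : ε < 1 / ((k : ℝ) - 1))
    (f : (Fin n → Fin (2 * k)) → Fin d → ℝ)
    (hnonneg : ∀ x, ∀ j, 0 ≤ f x j)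
    (hnorm : ∀ x, l1norm (f x) = 1)
    (hconstr : ∀ ℓ : ℕ, ℓ < n → ∀ x : Fin ℓ → Fin (2 * k), ∀ r : ℕ, 1 ≤ r → r ≤ k - 1 →
      1 - ε ≤ (1 / (2 * (k : ℝ))) * l1norm
        (∑ b : Fin k, (if (b : ℕ) < r then (1 : ℝ) else -1) •
          (fbar f (Fin.snoc x (⟨(b : ℕ), by have := b.isLt; omega⟩ : Fin (2 * k))) +
           fbar f (Fin.snoc x (⟨(b : ℕ) + k, by have := b.isLt; omega⟩ : Fin (2 * k)))))) :
    (2 : ℝ) ^ ((Real.logb 2 k - ((k : ℝ) - 1) * ε / 2 * Real.logb 2 ((k : ℝ) - 1)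
        - binH (((k : ℝ) - 1) * ε / 2)) * n) ≤ (d : ℝ) := by
  have hk0 : (0 : ℝ) < k := by
    have : 0 < k := by omega
    exact_mod_cast this
  set δ := ((k : ℝ) - 1) * ε / 2
  have key : ∀ m ℓ : ℕ, ℓ + m = n → ∀ x : Fin ℓ → Fin (2 * k),
      (∀ j, 0 ≤ fbar f x j) ∧ ∑ j, fbar f x j = 1 ∧
        m * fanoGain k δ ≤ ∑ j, Real.negMulLog (fbar f x j) := by
    intro m
    induction m with
    | zero =>
      intro ℓ hℓ x
      obtain rfl : ℓ = n := by omega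
      have hs : ∑ j, f x j = 1 := by
        rw [← hnorm x, l1norm]
        exact Finset.sum_congr rfl fun j _ => (abs_of_nonneg (hnonneg x j)).symm
      simp only [fbar_full]
      refine ⟨hnonneg x, hs, ?_⟩
      rw [Nat.cast_zero, zero_mul]
      refine Finset.sum_nonneg fun j _ => Real.negMulLog_nonneg (hnonneg x j) ?_
      rw [← hs]
      exact Finset.single_le_sum (fun j _ => hnonneg x j) (Finset.mem_univ j)
    | succ m ih =>
      intro ℓ hℓ x
      have ih' := fun c => ih (ℓ + 1) (by omega) (Fin.snoc x c)
      have hrec : ∀ j, fbar f x j =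
          (∑ c, fbar f (Fin.snoc x c : Fin (ℓ + 1) → Fin (2 * k)) j) / (2 * k) := fun j => by
        rw [fbar_eq_sum_snoc f (by omega) x, Pi.smul_apply, Finset.sum_apply, smul_eq_mul,
          inv_mul_eq_div]
        push_cast
        rfl
      refine ⟨fun j => ?_, ?_, ?_⟩
      · rw [hrec]
        exact div_nonneg (Finset.sum_nonneg fun c _ => (ih' c).1 j) (by positivity)
      · simp only [hrec]
        rw [← Finset.sum_div, Finset.sum_comm]
        simp only [fun c => (ih' c).2.1]
        simp [hk0.ne']
      · have hstep := entropy_average_ge hk hε0 hε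
          (fun b => fbar f (Fin.snoc x (⟨(b : ℕ), by have := b.isLt; omega⟩ : Fin (2 * k))))
          (fun b => fbar f (Fin.snoc x (⟨(b : ℕ) + k, by have := b.isLt; omega⟩ : Fin (2 * k))))
          (fun b => (ih' _).1) (fun b => (ih' _).1) (fun b => (ih' _).2.1)
          (fun b => (ih' _).2.1) (fun b => (ih' _).2.2) (fun b => (ih' _).2.2)
          (hconstr ℓ (by omega) x)
        simp only [hrec, sum_fin_two_mul]
        push_cast
        rw [add_mul, one_mul]
        exact hstep
  obtain ⟨h0, h1, h2⟩ := key n 0 (by omega) Fin.elim0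
  rw [two_rpow_eq_exp_fanoGain, ← Real.le_log_iff_exp_le (by exact_mod_cast hd)]
  exact h2.trans (sum_negMulLog_le_log_card hd _ h0 h1)
end
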